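/- Let P be a graded simplicial poset of rank n such that h_k(P) ≥ 0 for all 0 ≤ k ≤ n. Then for every T ⊆ [n], the chain polynomial f_{P̂_T}(x) of the rank-selected subposet P̂_T is real-rooted; moreover h(Δ(P̂_T), x) := Σ_{S ⊆ T} β_{P̂}(S) x^{|S|} is real-rooted and is interlaced by A^T_n(x). (In particular this holds when P is Cohen–Macaulay, since then h_k(P) ≥ 0 for all k.) -/

import Mathlib

open Polynomial

open scoped Classical

noncomputable section

/-- The descent set of a permutation `w` of `Fin n`, recorded as a subset of
`{1, ..., n-1}` (1-based positions, as in the paper: `i ∈ Des(w)` iff `w(i) > w(i+1)`). -/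
def descSet {n : ℕ} (w : Equiv.Perm (Fin n)) : Finset ℕ :=
  (Finset.univ.filter (fun i : Fin (n - 1) =>
      w ⟨i.val + 1, by have := i.isLt; omega⟩ < w ⟨i.val, by have := i.isLt; omega⟩)).image
    (fun i => i.val + 1)

/-- `A^T_n(x) = Σ_{w ∈ S_n, Des(w) ⊆ T} x^{des(w)}` (note `Des(w) ⊆ {1,...,n-1}`
automatically, so this also realizes the convention `A^T_n := A^{T ∩ [n-1]}_n`). -/
def Apoly (n : ℕ) (T : Finset ℕ) : Polynomial ℝ :=
  ∑ w ∈ Finset.univ.filter (fun w : Equiv.Perm (Fin n) => descSet w ⊆ T),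
    X ^ (descSet w).card

/-- `p^T_{n,k}(x) = Σ x^{des(w)}` over permutations `w ∈ S_{n+1}` with `w(1) = k+1`
(0-based: `w 0 = k`) and `Des(w) ⊆ T`. -/
def ppoly (n k : ℕ) (T : Finset ℕ) : Polynomial ℝ :=
  ∑ w ∈ Finset.univ.filter (fun w : Equiv.Perm (Fin (n + 1)) =>
      (w 0 : ℕ) = k ∧ descSet w ⊆ T),
    X ^ (descSet w).card

/-- A real polynomial has only real roots (or is identically zero). -/
def RealRooted (p : Polynomial ℝ) : Prop :=
  p = 0 ∨ ∀ z : ℂ, Polynomial.aeval z p = 0 → z.im = 0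

/-- The list of real roots of `p`, with multiplicity, in decreasing order. -/
def rootsDesc (p : Polynomial ℝ) : List ℝ :=
  (p.roots.sort (· ≤ ·)).reverse

/-- `Interlaces p q` means `p ⪯ q`: both are real-rooted and, listing the roots of `p`
as `α_1 ≥ α_2 ≥ ⋯` and those of `q` as `β_1 ≥ β_2 ≥ ⋯`, one has
`⋯ ≤ α_2 ≤ β_2 ≤ α_1 ≤ β_1`; by convention the zero polynomial interlaces and is
interlaced by every real-rooted polynomial. -/
def Interlaces (p q : Polynomial ℝ) : Prop :=
  (p = 0 ∧ RealRooted q) ∨ (q = 0 ∧ RealRooted p) ∨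
  (RealRooted p ∧ RealRooted q ∧
    Multiset.card q.roots ≤ Multiset.card p.roots + 1 ∧
    Multiset.card p.roots ≤ Multiset.card q.roots ∧
    (∀ (i : ℕ) (hp : i < (rootsDesc p).length) (hq : i < (rootsDesc q).length),
      (rootsDesc p).get ⟨i, hp⟩ ≤ (rootsDesc q).get ⟨i, hq⟩) ∧
    (∀ (i : ℕ) (hq : i + 1 < (rootsDesc q).length) (hp : i < (rootsDesc p).length),
      (rootsDesc q).get ⟨i + 1, hq⟩ ≤ (rootsDesc p).get ⟨i, hp⟩))

/-- The `T`-rank-selected subposet `P̂_T` of `P̂ = P ∪ {1̂}` (realized inside `WithTop P`):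
it consists of `0̂ = ⊥`, `1̂ = ⊤` and all elements of `P` whose rank lies in `T`. -/
def rankSel (P : Type*) [PartialOrder P] [OrderBot P] (ρ : P → ℕ) (T : Finset ℕ) :
    Set (WithTop P) :=
  {z | z = ⊤ ∨ z = ((⊥ : P) : WithTop P) ∨ ∃ y : P, z = (y : WithTop P) ∧ ρ y ∈ T}

/-- `α_{P̂}(T)`: the number of maximal chains of the rank-selected subposet `P̂_T`. -/
def alphaP (P : Type*) [PartialOrder P] [OrderBot P] (ρ : P → ℕ) (T : Finset ℕ) : ℕ :=
  Set.ncard {C : Set ↥(rankSel P ρ T) | IsMaxChain (· ≤ ·) C}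

/-- `β_{P̂}(T) = Σ_{S ⊆ T} (-1)^{|T∖S|} α_{P̂}(S)`. -/
def betaP (P : Type*) [PartialOrder P] [OrderBot P] (ρ : P → ℕ) (T : Finset ℕ) : ℤ :=
  ∑ S ∈ T.powerset, (-1 : ℤ) ^ (T.card - S.card) * (alphaP P ρ S : ℤ)

/-- The `h`-polynomial `h(P,x) = Σ_{i=0}^n f_{i-1}(P) x^i (1-x)^{n-i}` of a (graded,
rank `n`) simplicial poset `P`, where `f_{i-1}(P)` is the number of elements of rank `i`. -/
def hpolyP (P : Type*) [Fintype P] [PartialOrder P] (ρ : P → ℕ) (n : ℕ) : Polynomial ℤ :=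
  ∑ i ∈ Finset.range (n + 1),
    C (((Finset.univ.filter (fun y : P => ρ y = i)).card : ℤ)) * X ^ i * (1 - X) ^ (n - i)

/-- The chain polynomial `f_Q(x) = Σ_i c_i x^i` of a finite poset `Q`, where `c_i` is
the number of `i`-element chains of `Q`. -/
def chainPoly (Q : Type*) [PartialOrder Q] : Polynomial ℝ :=
  ∑ i ∈ Finset.range (Nat.card Q + 1),
    C ((Set.ncard {C : Set Q | IsChain (· ≤ ·) C ∧ C.ncard = i} : ℝ)) * X ^ i

/-- The recursively defined polynomials `p'_{n,k}`. -/
def Qp (T : Finset ℕ) : ℕ → ℕ → Polynomial ℝ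
  | 0, k => if k = 0 then 1 else 0
  | n + 1, k =>
      (∑ j ∈ (Finset.range (n + 1)).filter (fun j => k ≤ j), Qp T n j) +
      (if n + 1 ∈ T then X * ∑ j ∈ (Finset.range (n + 1)).filter (fun j => j < k), Qp T n j else 0)

/-- cone condition: `b / a` has argument in `[0, arg z]`. -/
def Cn (z a b : ℂ) : Prop :=
  0 ≤ b.im * a.re - b.re * a.im ∧
    0 ≤ (z.re * a.im + z.im * a.re) * b.re - (z.re * a.re - z.im * a.im) * b.im

lemma Cn_refl (z a : ℂ) (hz : 0 < z.im) : Cn z a a := by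
  constructor
  · apply le_of_eq; ring
  · have := mul_nonneg hz.le (add_nonneg (mul_self_nonneg a.re) (mul_self_nonneg a.im))
    nlinarith

lemma Cn_zero_right (z a : ℂ) : Cn z a 0 := by simp [Cn]
lemma Cn_zero_left (z a : ℂ) : Cn z 0 a := by simp [Cn]

lemma Cn_add_right {z a b c : ℂ} (h : Cn z a b) (h' : Cn z a c) : Cn z a (b + c) := by
  obtain ⟨h1, h2⟩ := h; obtain ⟨h3, h4⟩ := h'
  constructor
  · simp only [Complex.add_re, Complex.add_im]; linarith
  · simp only [Complex.add_re, Complex.add_im]; linarith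

lemma Cn_add_left {z a b c : ℂ} (h : Cn z a c) (h' : Cn z b c) : Cn z (a + b) c := by
  obtain ⟨h1, h2⟩ := h; obtain ⟨h3, h4⟩ := h'
  constructor
  · simp only [Complex.add_re, Complex.add_im]; linarith
  · simp only [Complex.add_re, Complex.add_im]; linarith

lemma Cn_smul_right {z a b : ℂ} (r : ℝ) (hr : 0 ≤ r) (h : Cn z a b) : Cn z a ((r : ℂ) * b) := by
  obtain ⟨h1, h2⟩ := h
  have h3 := mul_nonneg hr h1
  have h4 := mul_nonneg hr h2
  constructor
  · simp; linarith
  · simp; linarith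

lemma Cn_sum_right {ι : Type*} {z a : ℂ} (s : Finset ι) (f : ι → ℂ) (h : ∀ i ∈ s, Cn z a (f i)) :
    Cn z a (∑ i ∈ s, f i) := by
  induction s using Finset.induction_on with
  | empty => simpa using Cn_zero_right z a
  | insert i s hi ih =>
    rw [Finset.sum_insert hi]
    exact Cn_add_right (h _ (Finset.mem_insert_self _ _))
      (ih fun j hj => h j (Finset.mem_insert_of_mem hj))

lemma Cn_sum_left {ι : Type*} {z a : ℂ} (s : Finset ι) (f : ι → ℂ) (h : ∀ i ∈ s, Cn z (f i) a) :
    Cn z (∑ i ∈ s, f i) a := by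
  induction s using Finset.induction_on with
  | empty => simpa using Cn_zero_left z a
  | insert i s hi ih =>
    rw [Finset.sum_insert hi]
    exact Cn_add_left (h _ (Finset.mem_insert_self _ _))
      (ih fun j hj => h j (Finset.mem_insert_of_mem hj))

lemma Cn_add_ne {z a b : ℂ} (hz : 0 < z.im) (h : Cn z a b) (ha : a ≠ 0) : a + b ≠ 0 := by
  intro hab
  have hb : b = -a := by linear_combination hab
  subst hb
  have h2 := h.2
  simp only [Complex.neg_re, Complex.neg_im] at h2
  have h3 : z.im * (a.re * a.re + a.im * a.im) ≤ 0 := by linarith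
  have h4 : 0 < a.re * a.re + a.im * a.im := by
    have := Complex.normSq_pos.2 ha
    rwa [Complex.normSq_apply] at this
  have := mul_pos hz h4
  linarith

lemma Cn_step {z a b c : ℂ} (hz : 0 < z.im) (hab : Cn z a b) (hac : Cn z a c) (hbc : Cn z b c) :
    Cn z (b + c + z * a) (c + z * (a + b)) := by
  obtain ⟨h1, h2⟩ := hab
  obtain ⟨h3, h4⟩ := hac
  obtain ⟨h5, h6⟩ := hbc
  have hn : 0 ≤ z.re * z.re + z.im * z.im :=
    add_nonneg (mul_self_nonneg z.re) (mul_self_nonneg z.im)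
  have k1 := mul_nonneg hn h1
  have k2 := mul_nonneg hn h2
  have k5 := mul_nonneg hn h5
  have kb := mul_nonneg hz.le (add_nonneg (mul_self_nonneg b.re) (mul_self_nonneg b.im))
  have kc := mul_nonneg hz.le (add_nonneg (mul_self_nonneg (z * a + c).re)
    (mul_self_nonneg (z * a + c).im))
  constructor
  · simp only [Complex.add_re, Complex.add_im, Complex.mul_re, Complex.mul_im] at *
    linarith
  · simp only [Complex.add_re, Complex.add_im, Complex.mul_re, Complex.mul_im] at *
    linarith

lemma Qp_cone (T : Finset ℕ) (z : ℂ) (hz : 0 < z.im) (n : ℕ) :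
    (∀ i j, i ≤ j → Cn z (aeval z (Qp T n i)) (aeval z (Qp T n j))) ∧ aeval z (Qp T n 0) ≠ 0 := by
  induction n with
  | zero =>
    constructor
    · intro i j hij
      rcases hij.eq_or_lt with h | h
      · subst h; exact Cn_refl _ _ hz
      · have : Qp T 0 j = 0 := by simp [Qp]; omega
        rw [this]; simpa using Cn_zero_right z _
    · simp [Qp]
  | succ n ih =>
    obtain ⟨ih, ih0⟩ := ih
    have hsum : ∀ s t : Finset ℕ, (∀ i ∈ s, ∀ j ∈ t, i ≤ j) →
        Cn z (∑ i ∈ s, aeval z (Qp T n i)) (∑ j ∈ t, aeval z (Qp T n j)) := by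
      intro s t h
      exact Cn_sum_left _ _ fun i hi => Cn_sum_right _ _ fun j hj => ih i j (h i hi j hj)
    constructor
    · intro i j hij
      set R := Finset.range (n + 1)
      set A := ∑ l ∈ R.filter (fun l => l < i), aeval z (Qp T n l) with hA
      set B := ∑ l ∈ R.filter (fun l => i ≤ l ∧ l < j), aeval z (Qp T n l) with hB
      set D := ∑ l ∈ R.filter (fun l => j ≤ l), aeval z (Qp T n l) with hD
      have hAB : Cn z A B := hsum _ _ (by simp; intros; omega)
      have hAD : Cn z A D := hsum _ _ (by simp; intros; omega)
      have hBD : Cn z B D := hsum _ _ (by simp; intros; omega)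
      have e1 : ∑ l ∈ R.filter (fun l => i ≤ l), aeval z (Qp T n l) = B + D := by
        rw [hB, hD, ← Finset.sum_union]
        · congr 1; ext l; simp only [Finset.mem_union, Finset.mem_filter]; grind
        · rw [Finset.disjoint_left]; simp; intros; omega
      have e2 : ∑ l ∈ R.filter (fun l => l < j), aeval z (Qp T n l) = A + B := by
        rw [hA, hB, ← Finset.sum_union]
        · congr 1; ext l; simp only [Finset.mem_union, Finset.mem_filter]; grind
        · rw [Finset.disjoint_left]; simp; intros; omega
      rw [Qp, Qp]
      by_cases hT : n + 1 ∈ T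
      · simp only [hT, if_true, map_add, map_mul, map_sum, aeval_X]
        rw [e1, e2]
        exact Cn_step hz hAB hAD hBD
      · simp only [hT, if_false, map_sum, add_zero]
        rw [e1]
        exact Cn_add_left hBD (Cn_refl _ _ hz)
    · have : aeval z (Qp T (n + 1) 0) = ∑ j ∈ Finset.range (n + 1), aeval z (Qp T n j) := by
        rw [Qp]; simp
      rw [this, Finset.sum_range_succ', add_comm]
      exact Cn_add_ne hz (Cn_sum_right _ _ fun j _ => ih _ _ (Nat.zero_le _)) ih0

lemma Qp_nonneg (T : Finset ℕ) (n k i : ℕ) : 0 ≤ (Qp T n k).coeff i := by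
  induction n generalizing k i with
  | zero =>
    rw [Qp]; split_ifs
    · rw [coeff_one]; split_ifs <;> norm_num
    · simp
  | succ n ih =>
    rw [Qp, coeff_add]
    apply add_nonneg
    · rw [finsetSum_coeff]; exact Finset.sum_nonneg fun j _ => ih _ _
    · split_ifs
      · cases i with
        | zero => simp
        | succ i =>
          rw [coeff_X_mul, finsetSum_coeff]; exact Finset.sum_nonneg fun j _ => ih _ _
      · simp

/-- the nonnegative combination -/
lemma comb_cone (T : Finset ℕ) (z : ℂ) (hz : 0 < z.im) (n : ℕ) (h : ℕ → ℝ) (h0 : 0 < h 0)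
    (hh : ∀ k, 0 ≤ h k) :
    Cn z (aeval z (Qp T n 0)) (aeval z (∑ k ∈ Finset.range (n + 1), C (h k) * Qp T n k)) ∧
      aeval z (∑ k ∈ Finset.range (n + 1), C (h k) * Qp T n k) ≠ 0 := by
  obtain ⟨h1, h2⟩ := Qp_cone T z hz n
  have e : aeval z (∑ k ∈ Finset.range (n + 1), C (h k) * Qp T n k) =
      ∑ k ∈ Finset.range (n + 1), (h k : ℂ) * aeval z (Qp T n k) := by
    simp [map_sum]
  rw [e]
  refine ⟨Cn_sum_right _ _ fun k _ => Cn_smul_right _ (hh k) (h1 _ _ (Nat.zero_le _)), ?_⟩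
  rw [Finset.sum_range_succ', add_comm]
  have hne : (h 0 : ℂ) * aeval z (Qp T n 0) ≠ 0 := mul_ne_zero (by exact_mod_cast h0.ne') h2
  refine Cn_add_ne hz (Cn_sum_right _ _ fun k _ => Cn_smul_right _ (hh _) ?_) hne
  have h3 := h1 0 (k + 1) (Nat.zero_le _)
  obtain ⟨h4, h5⟩ := h3
  have h6 := mul_nonneg h0.le h4
  have h7 := mul_nonneg h0.le h5
  constructor
  · simp; linarith
  · simp; linarith

lemma nonreal_of_upper {p : Polynomial ℝ} (h : ∀ z : ℂ, 0 < z.im → aeval z p ≠ 0) :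
    RealRooted p := by
  right
  intro z hz
  rcases lt_trichotomy z.im 0 with h1 | h1 | h1
  · exfalso
    apply h ((starRingEnd ℂ) z) (by simpa using h1)
    rw [Polynomial.aeval_conj, hz, map_zero]
  · exact h1
  · exact absurd hz (h z h1)

/-- the argument of `s + iε - b` -/
def th (e s b : ℝ) : ℝ := Real.pi / 2 - Real.arctan ((s - b) / e)

lemma th_spec (e s b : ℝ) (he : 0 < e) :
    ∃ r : ℝ, 0 < r ∧ ((s : ℂ) + e * Complex.I - b) = r * Complex.exp ((th e s b : ℝ) * Complex.I) := by
  set u := (s - b) / e with hu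
  have hpos : 0 < Real.sqrt (1 + u ^ 2) := Real.sqrt_pos.2 (by positivity)
  refine ⟨e * Real.sqrt (1 + u ^ 2), by positivity, ?_⟩
  rw [Complex.exp_mul_I, ← Complex.ofReal_cos, ← Complex.ofReal_sin, th, Real.cos_pi_div_two_sub,
    Real.sin_pi_div_two_sub, Real.sin_arctan, Real.cos_arctan, ← hu]
  have hsb : s - b = e * u := by rw [hu]; field_simp
  apply Complex.ext
  · simp
    rw [hsb]; field_simp
  · simp
    field_simp

lemma prod_spec (e s : ℝ) (he : 0 < e) (m : Multiset ℝ) :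
    ∃ r : ℝ, 0 < r ∧ ((m.map (fun b : ℝ => ((s : ℂ) + e * Complex.I - b))).prod) =
      r * Complex.exp (((m.map (th e s)).sum : ℝ) * Complex.I) := by
  induction m using Multiset.induction_on with
  | empty => exact ⟨1, one_pos, by simp⟩
  | cons b m ih =>
    obtain ⟨r, hr, h⟩ := ih
    obtain ⟨r', hr', h'⟩ := th_spec e s b he
    refine ⟨r' * r, by positivity, ?_⟩
    rw [Multiset.map_cons, Multiset.prod_cons, h, h', Multiset.map_cons, Multiset.sum_cons]
    push_cast
    rw [add_mul, Complex.exp_add]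
    ring

lemma th_continuous (e b : ℝ) : Continuous (fun s => th e s b) := by
  unfold th; fun_prop

lemma thsum_continuous (e : ℝ) (m : Multiset ℝ) :
    Continuous (fun s => (m.map (th e s)).sum) := by
  induction m using Multiset.induction_on with
  | empty => simp [continuous_const]
  | cons b m ih =>
    simp only [Multiset.map_cons, Multiset.sum_cons]
    exact (th_continuous e b).add ih

lemma thsum_tendsto (e : ℝ) (he : 0 < e) (m : Multiset ℝ) :
    Filter.Tendsto (fun s => (m.map (th e s)).sum) Filter.atTop (nhds 0) := by
  induction m using Multiset.induction_on with
  | empty => simp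
  | cons b m ih =>
    simp only [Multiset.map_cons, Multiset.sum_cons]
    have h1 : Filter.Tendsto (fun s : ℝ => (s - b) / e) Filter.atTop Filter.atTop := by
      apply Filter.Tendsto.atTop_div_const he
      exact Filter.tendsto_atTop_add_const_right _ (-b) Filter.tendsto_id
    have h2 := (Real.tendsto_arctan_atTop.mono_right nhdsWithin_le_nhds).comp h1
    have h3 : Filter.Tendsto (fun s => th e s b) Filter.atTop (nhds 0) := by
      have := h2.const_sub (Real.pi / 2)
      simpa [th, Function.comp_def] using this
    simpa using h3.add ih

/-- number of elements `> t` -/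
def cnt (m : Multiset ℝ) (t : ℝ) : ℕ := m.countP (fun b => t < b)

lemma thsum_small (t : ℝ) (m : Multiset ℝ) (ht : t ∉ m) :
    Filter.Tendsto (fun e => (m.map (th e t)).sum) (nhdsWithin 0 (Set.Ioi 0))
      (nhds (Real.pi * cnt m t)) := by
  induction m using Multiset.induction_on with
  | empty => simp [cnt]
  | cons b m ih =>
    simp only [Multiset.mem_cons, not_or] at ht
    have ih := ih ht.2
    simp only [Multiset.map_cons, Multiset.sum_cons]
    by_cases hb : t < b
    · have e1 : cnt (b ::ₘ m) t = cnt m t + 1 := by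
        unfold cnt; rw [Multiset.countP_cons_of_pos _ (by simpa using hb)]
      have h1 : Filter.Tendsto (fun e : ℝ => (t - b) / e) (nhdsWithin 0 (Set.Ioi 0)) Filter.atBot := by
        have := tendsto_inv_nhdsGT_zero (𝕜 := ℝ)
        simpa [div_eq_mul_inv] using this.const_mul_atTop_of_neg (r := t - b) (by linarith)
      have h2 := (Real.tendsto_arctan_atBot.mono_right nhdsWithin_le_nhds).comp h1
      have h3 := h2.const_sub (Real.pi / 2)
      have h4 := h3.add ih
      rw [e1]
      have e2 : Real.pi * ((cnt m t + 1 : ℕ) : ℝ) =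
          Real.pi / 2 - -(Real.pi / 2) + Real.pi * cnt m t := by push_cast; ring
      rw [e2]
      exact h4
    · have hb' : b < t := lt_of_le_of_ne (not_lt.1 hb) (fun h => ht.1 h.symm)
      have e1 : cnt (b ::ₘ m) t = cnt m t := by
        unfold cnt; rw [Multiset.countP_cons_of_neg _ (by simpa using hb)]
      have h1 : Filter.Tendsto (fun e : ℝ => (t - b) / e) (nhdsWithin 0 (Set.Ioi 0)) Filter.atTop := by
        have := tendsto_inv_nhdsGT_zero (𝕜 := ℝ)
        simpa [div_eq_mul_inv] using this.const_mul_atTop (r := t - b) (by linarith)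
      have h2 := (Real.tendsto_arctan_atTop.mono_right nhdsWithin_le_nhds).comp h1
      have h3 := h2.const_sub (Real.pi / 2)
      have h4 := h3.add ih
      rw [e1]
      have e2 : Real.pi * (cnt m t : ℝ) =
          Real.pi / 2 - Real.pi / 2 + Real.pi * cnt m t := by ring
      rw [e2]
      exact h4

/-- real-rooted nonzero polynomials split. -/
lemma splits_of_realRooted {p : Polynomial ℝ} (hp : p ≠ 0) (h : RealRooted p) : p.Splits := by
  have h := h.resolve_left hp
  rw [splits_iff_splits]
  right
  intro g hg hgp
  obtain ⟨z, hz⟩ := IsAlgClosed.exists_aeval_eq_zero ℂ g hg.degree_pos.ne'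
  have hpz : aeval z p = 0 := by
    obtain ⟨c, rfl⟩ := hgp
    rw [map_mul, hz, zero_mul]
  have hzr : z = (z.re : ℂ) := Complex.ext rfl (by simpa using h z hpz)
  rw [hzr] at hz
  refine degree_eq_one_of_irreducible_of_root hg (x := z.re) ?_
  have h3 : aeval ((algebraMap ℝ ℂ) z.re) g = 0 := hz
  rw [aeval_algebraMap_apply] at h3
  simpa [IsRoot] using h3

lemma eval_form {p : Polynomial ℝ} (hs : p.Splits) (z : ℂ) :
    aeval z p = (p.leadingCoeff : ℂ) * (p.roots.map (fun b : ℝ => z - b)).prod := by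
  conv_lhs => rw [hs.eq_prod_roots]
  rw [map_mul, aeval_C, map_multiset_prod, Multiset.map_map]
  simp

lemma phase_bound (m₁ m₂ : Multiset ℝ)
    (h : ∀ e s : ℝ, 0 < e → 0 ≤ Real.sin ((m₂.map (th e s)).sum - (m₁.map (th e s)).sum))
    (e s : ℝ) (he : 0 < e) :
    0 ≤ (m₂.map (th e s)).sum - (m₁.map (th e s)).sum ∧
      (m₂.map (th e s)).sum - (m₁.map (th e s)).sum ≤ Real.pi := by
  set f : ℝ → ℝ := fun s => (m₂.map (th e s)).sum - (m₁.map (th e s)).sum with hf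
  have hc : Continuous f := (thsum_continuous e m₂).sub (thsum_continuous e m₁)
  have ht : Filter.Tendsto f Filter.atTop (nhds 0) := by
    simpa using (thsum_tendsto e he m₂).sub (thsum_tendsto e he m₁)
  have hpi := Real.pi_pos
  have hsm : ∃ s₁, |f s₁| < Real.pi / 2 := by
    have := (Metric.tendsto_nhds.1 ht (Real.pi / 2) (by positivity)).exists
    simpa [Real.dist_eq] using this
  obtain ⟨s₁, hs₁⟩ := hsm
  rw [abs_lt] at hs₁
  have hsin : ∀ x, 0 ≤ Real.sin (f x) := fun x => h e x he
  have key : ∀ c, c ∉ Set.range f → f s < c ∨ c < f s := by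
    intro c hc'
    rcases lt_trichotomy (f s) c with h | h | h
    · exact Or.inl h
    · exact absurd ⟨s, h⟩ hc'
    · exact Or.inr h
  have hord : (Set.range f).OrdConnected := by
    have : IsPreconnected (Set.range f) := isPreconnected_range hc
    exact this.ordConnected
  have gt : ∀ c, Real.sin c < 0 → c ∉ Set.range f := by
    rintro c hc' ⟨x, rfl⟩
    exact absurd (hsin x) (not_le.2 hc')
  change 0 ≤ f s ∧ f s ≤ Real.pi
  constructor
  · by_contra hneg
    push Not at hneg
    have h1 : -Real.pi / 2 < f s := by
      by_contra h2
      push Not at h2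
      refine gt (-Real.pi / 2) ?_ (hord.out ⟨s, rfl⟩ ⟨s₁, rfl⟩ ⟨h2, by linarith⟩)
      rw [neg_div, Real.sin_neg, Real.sin_pi_div_two]; norm_num
    have := Real.sin_neg_of_neg_of_neg_pi_lt hneg (by linarith)
    linarith [hsin s]
  · by_contra hneg
    push Not at hneg
    have h1 : f s < 3 * Real.pi / 2 := by
      by_contra h2
      push Not at h2
      refine gt (3 * Real.pi / 2) ?_ (hord.out ⟨s₁, rfl⟩ ⟨s, rfl⟩ ⟨by linarith, h2⟩)
      have : 3 * Real.pi / 2 = Real.pi / 2 + Real.pi := by ring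
      rw [this, Real.sin_add_pi, Real.sin_pi_div_two]; norm_num
    have h3 := Real.sin_pos_of_pos_of_lt_pi (x := f s - Real.pi) (by linarith) (by linarith)
    rw [Real.sin_sub_pi] at h3
    linarith [hsin s]

lemma cnt_bound {p q : Polynomial ℝ} (hp : p.Splits) (hq : q.Splits)
    (lp : 0 < p.leadingCoeff) (lq : 0 < q.leadingCoeff)
    (h : ∀ z : ℂ, 0 < z.im → Cn z (aeval z p) (aeval z q)) (t : ℝ) (h1 : t ∉ p.roots)
    (h2 : t ∉ q.roots) :
    cnt p.roots t ≤ cnt q.roots t ∧ cnt q.roots t ≤ cnt p.roots t + 1 := by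
  have hs : ∀ e s : ℝ, 0 < e →
      0 ≤ Real.sin ((q.roots.map (th e s)).sum - (p.roots.map (th e s)).sum) := by
    intro e s he
    have hz := (h ((s : ℂ) + e * Complex.I) (by simpa using he)).1
    rw [eval_form hp, eval_form hq] at hz
    obtain ⟨r, hr, e1⟩ := prod_spec e s he p.roots
    obtain ⟨r', hr', e2⟩ := prod_spec e s he q.roots
    rw [e1, e2] at hz
    set x := (p.roots.map (th e s)).sum
    set y := (q.roots.map (th e s)).sum
    rw [Real.sin_sub]
    rw [Complex.exp_mul_I, Complex.exp_mul_I, ← Complex.ofReal_cos, ← Complex.ofReal_sin,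
      ← Complex.ofReal_cos, ← Complex.ofReal_sin] at hz
    simp only [Complex.mul_re, Complex.mul_im, Complex.add_re, Complex.add_im, Complex.ofReal_re,
      Complex.ofReal_im, Complex.I_re, Complex.I_im] at hz
    have hpos : 0 < q.leadingCoeff * r' * (p.leadingCoeff * r) := by positivity
    have : 0 ≤ (q.leadingCoeff * r' * (p.leadingCoeff * r)) *
      (Real.sin y * Real.cos x - Real.cos y * Real.sin x) := by linarith
    exact nonneg_of_mul_nonneg_right this hpos
  have lim := (thsum_small t q.roots h2).sub (thsum_small t p.roots h1)
  have hb := phase_bound _ _ hs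
  have l1 := ge_of_tendsto lim (b := 0) (by
    filter_upwards [self_mem_nhdsWithin] with e he using (hb e t he).1)
  have l2 := le_of_tendsto lim (b := Real.pi) (by
    filter_upwards [self_mem_nhdsWithin] with e he using (hb e t he).2)
  have hpi := Real.pi_pos
  constructor
  · have : (cnt p.roots t : ℝ) ≤ cnt q.roots t := by nlinarith
    exact_mod_cast this
  · have : (cnt q.roots t : ℝ) ≤ cnt p.roots t + 1 := by nlinarith
    exact_mod_cast this

lemma rootsDesc_coe (p : Polynomial ℝ) : ((rootsDesc p : List ℝ) : Multiset ℝ) = p.roots := by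
  unfold rootsDesc
  rw [Multiset.coe_reverse, Multiset.sort_eq]

lemma rootsDesc_sorted (p : Polynomial ℝ) : (rootsDesc p).Pairwise (· ≥ ·) := by
  unfold rootsDesc
  rw [List.pairwise_reverse]
  exact Multiset.pairwise_sort _ _

lemma countP_ge {l : List ℝ} (hl : l.Pairwise (· ≥ ·)) (i : ℕ) (hi : i < l.length) (t : ℝ)
    (h : t < l[i]) : i + 1 ≤ l.countP (fun b => t < b) := by
  have h1 : (l.take (i + 1)).countP (fun b => t < b) = (l.take (i + 1)).length := by
    rw [List.countP_eq_length]
    intro a ha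
    rw [List.mem_take_iff_getElem] at ha
    obtain ⟨j, hj, rfl⟩ := ha
    have hj' : j ≤ i := by omega
    simp only [decide_eq_true_eq]
    rcases hj'.eq_or_lt with h' | h'
    · subst h'; exact h
    · exact lt_of_lt_of_le h (List.pairwise_iff_getElem.1 hl j i (by omega) hi h')
  have h2 := (List.take_sublist (i + 1) l).countP_le (p := fun b => decide (t < b))
  rw [h1, List.length_take] at h2
  omega

lemma countP_le {l : List ℝ} (hl : l.Pairwise (· ≥ ·)) (i : ℕ) (hi : i < l.length) (t : ℝ)
    (h : l[i] < t) : l.countP (fun b => t < b) ≤ i := by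
  have h1 : (l.drop i).countP (fun b => t < b) = 0 := by
    rw [List.countP_eq_zero]
    intro a ha
    rw [List.mem_drop_iff_getElem] at ha
    obtain ⟨j, hj, rfl⟩ := ha
    simp only [decide_eq_true_eq, not_lt]
    rcases Nat.eq_zero_or_pos j with h' | h'
    · subst h'; simpa using h.le
    · exact le_trans (List.pairwise_iff_getElem.1 hl i (i + j) (by omega) (by omega) (by omega)) h.le
  have h2 : l.countP (fun b => decide (t < b)) = (l.take i ++ l.drop i).countP (fun b => decide (t < b)) := by
    rw [List.take_append_drop]
  rw [h2, List.countP_append, h1]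
  have := List.countP_le_length (p := fun b => decide (t < b)) (l := l.take i)
  rw [List.length_take] at this
  omega

lemma exists_between_not_mem (m : Multiset ℝ) {a b : ℝ} (h : a < b) :
    ∃ t, a < t ∧ t < b ∧ t ∉ m := by
  have h1 := (Set.Ioo_infinite h).sdiff (Finset.finite_toSet m.toFinset)
  obtain ⟨t, ht⟩ := h1.nonempty
  exact ⟨t, ht.1.1, ht.1.2, by simpa using ht.2⟩

lemma exists_lt_all (m : Multiset ℝ) : ∃ t, ∀ b ∈ m, t < b := by
  induction m using Multiset.induction_on with
  | empty => exact ⟨0, by simp⟩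
  | cons b m ih =>
    obtain ⟨t, ht⟩ := ih
    refine ⟨min t b - 1, ?_⟩
    intro c hc
    rcases Multiset.mem_cons.1 hc with h | h
    · subst h; linarith [min_le_right t c]
    · linarith [ht c h, min_le_left t b]

lemma interlaces_of_cone {p q : Polynomial ℝ} (rp : RealRooted p) (rq : RealRooted q)
    (lp : 0 < p.leadingCoeff) (lq : 0 < q.leadingCoeff)
    (h : ∀ z : ℂ, 0 < z.im → Cn z (aeval z p) (aeval z q)) : Interlaces p q := by
  have p0 : p ≠ 0 := by rintro rfl; simp at lp
  have q0 : q ≠ 0 := by rintro rfl; simp at lq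
  have key : ∀ t, t ∉ p.roots + q.roots →
      (rootsDesc p).countP (fun b => t < b) ≤ (rootsDesc q).countP (fun b => t < b) ∧
      (rootsDesc q).countP (fun b => t < b) ≤ (rootsDesc p).countP (fun b => t < b) + 1 := by
    intro t ht
    rw [Multiset.mem_add, not_or] at ht
    have := cnt_bound (splits_of_realRooted p0 rp) (splits_of_realRooted q0 rq) lp lq h t ht.1 ht.2
    unfold cnt at this
    rw [← rootsDesc_coe p, ← rootsDesc_coe q, Multiset.coe_countP, Multiset.coe_countP] at this
    exact this
  right; right
  have hlen : Multiset.card q.roots ≤ Multiset.card p.roots + 1 ∧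
      Multiset.card p.roots ≤ Multiset.card q.roots := by
    obtain ⟨t, ht⟩ := exists_lt_all (p.roots + q.roots)
    have := key t (fun h => lt_irrefl _ (ht t h))
    have e : ∀ r : Polynomial ℝ, (∀ b ∈ r.roots, t < b) →
        (rootsDesc r).countP (fun b => t < b) = Multiset.card r.roots := by
      intro r hr
      rw [← rootsDesc_coe r, Multiset.coe_card, List.countP_eq_length]
      intro a ha
      rw [decide_eq_true_eq]
      apply hr
      rw [← rootsDesc_coe r]; exact ha
    rw [e p (fun b hb => ht b (Multiset.mem_add.2 (Or.inl hb))),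
      e q (fun b hb => ht b (Multiset.mem_add.2 (Or.inr hb)))] at this
    exact ⟨this.2, this.1⟩
  refine ⟨rp, rq, hlen.1, hlen.2, ?_, ?_⟩
  · intro i hi hi'
    by_contra hlt
    push Not at hlt
    obtain ⟨t, h1, h2, h3⟩ := exists_between_not_mem (p.roots + q.roots) hlt
    have a1 := countP_ge (rootsDesc_sorted p) i hi t h2
    have a2 := countP_le (rootsDesc_sorted q) i hi' t h1
    have := (key t h3).1
    omega
  · intro i hi hi'
    by_contra hlt
    push Not at hlt
    obtain ⟨t, h1, h2, h3⟩ := exists_between_not_mem (p.roots + q.roots) hlt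
    have a1 := countP_ge (rootsDesc_sorted q) (i + 1) hi t h2
    have a2 := countP_le (rootsDesc_sorted p) i hi' t h1
    have := (key t h3).2
    omega

/-- flag numbers: `a_{n,k}(S)`. -/
def av (S : Finset ℕ) : ℕ → ℕ → ℕ
  | 0, k => if k = 0 then 1 else 0
  | n + 1, k =>
      if n + 1 ∈ S then ∑ j ∈ Finset.range (n + 1), av S n j
      else ∑ j ∈ (Finset.range (n + 1)).filter (fun j => k ≤ j), av S n j

lemma av_congr (S S' : Finset ℕ) (n : ℕ) (h : ∀ i, 1 ≤ i → i ≤ n → (i ∈ S ↔ i ∈ S')) (k : ℕ) :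
    av S n k = av S' n k := by
  induction n generalizing k with
  | zero => rfl
  | succ n ih =>
    have ih' := ih (fun i h1 h2 => h i h1 (by omega))
    rw [av, av]
    simp only [h (n + 1) (by omega) le_rfl, ih']

lemma Qp_eq_sum (T : Finset ℕ) (n k : ℕ) :
    Qp T n k = ∑ S ∈ (T ∩ Finset.Icc 1 n).powerset,
      C (av S n k : ℝ) * (X ^ S.card * (1 - X) ^ ((T ∩ Finset.Icc 1 n).card - S.card)) := by
  induction n generalizing k with
  | zero =>
    simp [Qp, av]
  | succ n ih =>
    by_cases hT : n + 1 ∈ T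
    · have e : T ∩ Finset.Icc 1 (n + 1) = insert (n + 1) (T ∩ Finset.Icc 1 n) := by
        ext i; simp only [Finset.mem_inter, Finset.mem_Icc, Finset.mem_insert]
        constructor
        · rintro ⟨h1, h2, h3⟩
          by_cases h : i = n + 1
          · exact Or.inl h
          · exact Or.inr ⟨h1, h2, by omega⟩
        · rintro (h | ⟨h1, h2, h3⟩)
          · subst h; exact ⟨hT, by omega, le_rfl⟩
          · exact ⟨h1, h2, by omega⟩
      have hn : n + 1 ∉ T ∩ Finset.Icc 1 n := by simp
      rw [e, Finset.sum_powerset_insert hn]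
      set U := T ∩ Finset.Icc 1 n with hU
      have f1 : ∀ S ∈ U.powerset,
          C (av S (n + 1) k : ℝ) * (X ^ S.card * (1 - X) ^ ((insert (n + 1) U).card - S.card)) =
          ∑ j ∈ (Finset.range (n + 1)).filter (fun j => k ≤ j),
            (1 - X) * (C (av S n j : ℝ) * (X ^ S.card * (1 - X) ^ (U.card - S.card))) := by
        intro S hS
        rw [Finset.mem_powerset] at hS
        have hnS : n + 1 ∉ S := fun h => hn (hS h)
        have hc := Finset.card_le_card hS
        rw [av, if_neg hnS, Finset.card_insert_of_notMem hn,
          show U.card + 1 - S.card = (U.card - S.card) + 1 by omega]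
        push_cast
        rw [map_sum, Finset.sum_mul]
        refine Finset.sum_congr rfl fun j _ => ?_
        ring
      have f2 : ∀ S ∈ U.powerset,
          C (av (insert (n + 1) S) (n + 1) k : ℝ) * (X ^ (insert (n + 1) S).card *
            (1 - X) ^ ((insert (n + 1) U).card - (insert (n + 1) S).card)) =
          ∑ j ∈ (Finset.range (n + 1)),
            X * (C (av S n j : ℝ) * (X ^ S.card * (1 - X) ^ (U.card - S.card))) := by
        intro S hS
        rw [Finset.mem_powerset] at hS
        have hnS : n + 1 ∉ S := fun h => hn (hS h)
        rw [av, if_pos (Finset.mem_insert_self _ _), Finset.card_insert_of_notMem hn,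
          Finset.card_insert_of_notMem hnS, Nat.add_sub_add_right]
        have : ∀ j, av (insert (n + 1) S) n j = av S n j := fun j =>
          av_congr _ _ n (fun i h1 h2 => by simp; omega) j
        simp only [this]
        push_cast
        rw [map_sum, Finset.sum_mul]
        refine Finset.sum_congr rfl fun j _ => ?_
        ring
      rw [Finset.sum_congr rfl f1, Finset.sum_congr rfl f2, Finset.sum_comm,
        Finset.sum_comm (s := U.powerset) (t := Finset.range (n + 1))]
      simp only [← Finset.mul_sum]
      simp only [← ih]
      rw [Qp, if_pos hT]
      have hsplit : ∑ j ∈ Finset.range (n + 1), Qp T n j =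
          ∑ j ∈ (Finset.range (n + 1)).filter (fun j => k ≤ j), Qp T n j +
          ∑ j ∈ (Finset.range (n + 1)).filter (fun j => j < k), Qp T n j := by
        rw [← Finset.sum_filter_add_sum_filter_not (Finset.range (n + 1)) (fun j => k ≤ j)]
        simp only [not_le]
      rw [hsplit]
      ring
    · have e : T ∩ Finset.Icc 1 (n + 1) = T ∩ Finset.Icc 1 n := by
        ext i; simp only [Finset.mem_inter, Finset.mem_Icc]
        constructor
        · rintro ⟨h1, h2, h3⟩
          by_cases h : i = n + 1
          · subst h; exact absurd h1 hT
          · exact ⟨h1, h2, by omega⟩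
        · rintro ⟨h1, h2, h3⟩
          exact ⟨h1, h2, by omega⟩
      rw [e]
      set U := T ∩ Finset.Icc 1 n with hU
      have f1 : ∀ S ∈ U.powerset,
          C (av S (n + 1) k : ℝ) * (X ^ S.card * (1 - X) ^ (U.card - S.card)) =
          ∑ j ∈ (Finset.range (n + 1)).filter (fun j => k ≤ j),
            (C (av S n j : ℝ) * (X ^ S.card * (1 - X) ^ (U.card - S.card))) := by
        intro S hS
        rw [Finset.mem_powerset] at hS
        have hnS : n + 1 ∉ S := fun h => hT (Finset.mem_inter.1 (hS h)).1
        rw [av, if_neg hnS]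
        push_cast
        rw [map_sum, Finset.sum_mul]
      rw [Finset.sum_congr rfl f1, Finset.sum_comm, Qp, if_neg hT, add_zero]
      exact Finset.sum_congr rfl fun j _ => ih j

lemma hockey (n m k : ℕ) :
    ∑ j ∈ (Finset.range (n + 1)).filter (fun j => k ≤ j), (n - j).choose m =
      (n + 1 - k).choose (m + 1) := by
  induction n generalizing k with
  | zero =>
    rcases Nat.eq_zero_or_pos k with h | h
    · subst h; cases m <;> simp [Nat.choose_eq_zero_of_lt]
    · have : (Finset.range 1).filter (fun j => k ≤ j) = ∅ := by
        ext j; simp; omega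
      rw [this, show 0 + 1 - k = 0 by omega]; simp
  | succ n ih =>
    rw [Finset.sum_filter, Finset.sum_range_succ']
    simp only [Nat.add_sub_add_right, Nat.sub_zero]
    cases k with
    | zero =>
      have h := ih 0
      rw [Finset.sum_filter] at h
      simp only [Nat.zero_le, if_true, Nat.sub_zero] at h ⊢
      rw [h, Nat.choose_succ_succ' (n + 1) m, add_comm]
    | succ k =>
      have h := ih k
      rw [Finset.sum_filter] at h
      simp only [Nat.add_le_add_iff_right, Nat.add_sub_add_right]
      rw [h]
      simp

lemma av_closed (S : Finset ℕ) (m : ℕ) (hm : m ∈ S ∨ m = 0) (d : ℕ)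
    (h : ∀ i, m < i → i ≤ m + d → i ∉ S) (k : ℕ) (hk : k ≤ m + d) :
    av S (m + d) k = (m + d - k).choose d * av S m 0 := by
  induction d generalizing k with
  | zero =>
    simp only [add_zero, Nat.choose_zero_right, one_mul]
    cases m with
    | zero => rw [show k = 0 by omega]
    | succ m =>
      have : m + 1 ∈ S := by simpa using hm
      rw [av, av, if_pos this, if_pos this]
  | succ d ih =>
    rw [← add_assoc, av, if_neg (h _ (by omega) (by omega)), ← hockey, Finset.sum_mul]
    refine Finset.sum_congr rfl fun j hj => ?_
    simp at hj
    exact ih (fun i h1 h2 => h i h1 (by omega)) j (by omega)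

lemma mem_descSet {n : ℕ} (w : Equiv.Perm (Fin (n + 1))) (i : ℕ) :
    i + 1 ∈ descSet w ↔ ∃ h : i < n, w ⟨i + 1, by omega⟩ < w ⟨i, by omega⟩ := by
  unfold descSet
  simp only [Finset.mem_image, Finset.mem_filter, Finset.mem_univ, true_and]
  constructor
  · rintro ⟨j, hj, hji⟩
    have : j.val = i := by omega
    subst this
    exact ⟨by have := j.isLt; omega, hj⟩
  · rintro ⟨h, hw⟩
    exact ⟨⟨i, by omega⟩, hw, rfl⟩

lemma zero_notMem_descSet {n : ℕ} (w : Equiv.Perm (Fin n)) : 0 ∉ descSet w := by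
  simp [descSet]

/-- append a last letter `v` -/
def appendFun {n : ℕ} (u : Equiv.Perm (Fin n)) (v : Fin (n + 1)) : Fin (n + 1) → Fin (n + 1) :=
  Fin.lastCases v (fun i => v.succAbove (u i))

lemma appendFun_inj {n : ℕ} (u : Equiv.Perm (Fin n)) (v : Fin (n + 1)) :
    Function.Injective (appendFun u v) := by
  intro a b
  refine Fin.lastCases ?_ (fun i => ?_) a <;> refine Fin.lastCases ?_ (fun j => ?_) b
  · simp
  · simp only [appendFun, Fin.lastCases_last, Fin.lastCases_castSucc]
    intro h; exact absurd h.symm (Fin.succAbove_ne _ _)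
  · simp only [appendFun, Fin.lastCases_last, Fin.lastCases_castSucc]
    intro h; exact absurd h (Fin.succAbove_ne _ _)
  · simp only [appendFun, Fin.lastCases_castSucc]
    intro h
    rw [u.injective (Fin.succAbove_right_injective h)]

/-- append a last letter `v`, as a permutation -/
def appendPerm {n : ℕ} (x : Equiv.Perm (Fin n) × Fin (n + 1)) : Equiv.Perm (Fin (n + 1)) :=
  Equiv.ofBijective (appendFun x.1 x.2) (Finite.injective_iff_bijective.1 (appendFun_inj x.1 x.2))

lemma appendPerm_last {n : ℕ} (x : Equiv.Perm (Fin n) × Fin (n + 1)) :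
    appendPerm x (Fin.last n) = x.2 := by
  simp [appendPerm, appendFun]

lemma appendPerm_castSucc {n : ℕ} (x : Equiv.Perm (Fin n) × Fin (n + 1)) (i : Fin n) :
    appendPerm x i.castSucc = x.2.succAbove (x.1 i) := by
  simp [appendPerm, appendFun]

lemma appendPerm_bij (n : ℕ) : Function.Bijective (appendPerm (n := n)) := by
  rw [Fintype.bijective_iff_injective_and_card]
  constructor
  · intro x y h
    have h2 : x.2 = y.2 := by rw [← appendPerm_last x, ← appendPerm_last y, h]
    refine Prod.ext ?_ h2
    ext i
    have h3 := appendPerm_castSucc x i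
    rw [h, appendPerm_castSucc, h2] at h3
    rw [Fin.succAbove_right_injective h3]
  · simp [Fintype.card_perm, Nat.factorial_succ, mul_comm]

lemma descSet_append {n : ℕ} (x : Equiv.Perm (Fin (n + 1)) × Fin (n + 2)) :
    descSet (appendPerm x) =
      if x.2.val ≤ (x.1 (Fin.last n)).val then insert (n + 1) (descSet x.1) else descSet x.1 := by
  have hlast : n + 1 ∈ descSet (appendPerm x) ↔ x.2.val ≤ (x.1 (Fin.last n)).val := by
    rw [mem_descSet]
    have e1 : (⟨n + 1, by omega⟩ : Fin (n + 2)) = Fin.last (n + 1) := rfl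
    have e2 : (⟨n, by omega⟩ : Fin (n + 2)) = (Fin.last n).castSucc := rfl
    simp only [e1, e2, appendPerm_last, appendPerm_castSucc, Fin.lt_succAbove_iff_le_castSucc]
    simp [Fin.le_def]
  have hlow : ∀ i, i ≠ n + 1 → (i ∈ descSet (appendPerm x) ↔ i ∈ descSet x.1) := by
    intro i hi
    cases i with
    | zero => simp [zero_notMem_descSet]
    | succ i =>
      rw [mem_descSet, mem_descSet]
      constructor
      · rintro ⟨h, hw⟩
        have hin : i < n := by omega
        refine ⟨hin, ?_⟩
        have e1 : (⟨i + 1, by omega⟩ : Fin (n + 2)) = Fin.castSucc ⟨i + 1, by omega⟩ := rfl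
        have e2 : (⟨i, by omega⟩ : Fin (n + 2)) = Fin.castSucc ⟨i, by omega⟩ := rfl
        rw [e1, e2, appendPerm_castSucc, appendPerm_castSucc] at hw
        exact (Fin.strictMono_succAbove _).lt_iff_lt.1 hw
      · rintro ⟨h, hw⟩
        refine ⟨by omega, ?_⟩
        have e1 : (⟨i + 1, by omega⟩ : Fin (n + 2)) = Fin.castSucc ⟨i + 1, by omega⟩ := rfl
        have e2 : (⟨i, by omega⟩ : Fin (n + 2)) = Fin.castSucc ⟨i, by omega⟩ := rfl
        rw [e1, e2, appendPerm_castSucc, appendPerm_castSucc]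
        exact (Fin.strictMono_succAbove _).lt_iff_lt.2 hw
  have hnot : n + 1 ∉ descSet x.1 := by
    rw [mem_descSet]; rintro ⟨h, -⟩; omega
  ext i
  by_cases hi : i = n + 1
  · subst hi
    rw [hlast]
    split_ifs with h
    · simp [h]
    · simp [h, hnot]
  · rw [hlow i hi]
    split_ifs
    · simp [hi]
    · rfl

/-- permutation version of `Qp` -/
def Rp (T : Finset ℕ) (n k : ℕ) : Polynomial ℝ :=
  ∑ w : Equiv.Perm (Fin (n + 1)),
    if (w (Fin.last n)).val + k = n ∧ descSet w ⊆ T then X ^ (descSet w).card else 0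

lemma sum_Rp (T : Finset ℕ) (n : ℕ) (p : ℕ → Prop) [DecidablePred p] :
    ∑ j ∈ (Finset.range (n + 1)).filter p, Rp T n j =
      ∑ w : Equiv.Perm (Fin (n + 1)),
        if p (n - (w (Fin.last n)).val) ∧ descSet w ⊆ T then X ^ (descSet w).card else 0 := by
  unfold Rp
  rw [Finset.sum_comm]
  refine Finset.sum_congr rfl fun w _ => ?_
  have hw := (w (Fin.last n)).isLt
  by_cases hd : descSet w ⊆ T
  · simp only [hd, and_true]
    rw [Finset.sum_filter]
    rw [Finset.sum_eq_single (n - (w (Fin.last n)).val)]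
    · rw [if_pos (show (w (Fin.last n)).val + (n - (w (Fin.last n)).val) = n by omega)]
    · intro j hj hne
      simp at hj
      rw [if_neg (show ¬ (w (Fin.last n)).val + j = n by omega)]
      exact ite_self _
    · intro h; exact absurd (Finset.mem_range.2 (by omega)) h
  · simp [hd]

lemma Rp_eq (T : Finset ℕ) (n k : ℕ) (hk : k ≤ n) : Rp T n k = Qp T n k := by
  induction n generalizing k with
  | zero =>
    have : k = 0 := by omega
    subst this
    simp [Rp, Qp, descSet]
  | succ n ih =>
    have e : ∀ (p : ℕ → Prop) [DecidablePred p], ∑ j ∈ (Finset.range (n + 1)).filter p, Qp T n j =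
        ∑ j ∈ (Finset.range (n + 1)).filter p, Rp T n j := fun p _ =>
      Finset.sum_congr rfl fun j hj => (ih j (by simp at hj; omega)).symm
    rw [Qp, e, e, sum_Rp, sum_Rp, Rp, ← (Equiv.ofBijective _ (appendPerm_bij (n + 1))).sum_comp,
      Fintype.sum_prod_type]
    have hv : ∀ u : Equiv.Perm (Fin (n + 1)),
        (∑ v : Fin (n + 2), if (((Equiv.ofBijective _ (appendPerm_bij (n + 1))) (u, v)) (Fin.last (n + 1))).val + k = n + 1 ∧
          descSet ((Equiv.ofBijective _ (appendPerm_bij (n + 1))) (u, v)) ⊆ T then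
          (X : Polynomial ℝ) ^ (descSet ((Equiv.ofBijective _ (appendPerm_bij (n + 1))) (u, v))).card else 0) =
        (if k ≤ n - (u (Fin.last n)).val ∧ descSet u ⊆ T then X ^ (descSet u).card else 0) +
        (if n + 1 ∈ T then X * (if n - (u (Fin.last n)).val < k ∧ descSet u ⊆ T then
          X ^ (descSet u).card else 0) else 0) := by
      intro u
      simp only [Equiv.ofBijective_apply, appendPerm_last]
      have hu := (u (Fin.last n)).isLt
      rw [Finset.sum_eq_single (⟨n + 1 - k, by omega⟩ : Fin (n + 2))]
      · have hnot : n + 1 ∉ descSet u := by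
          rw [mem_descSet]; rintro ⟨h, -⟩; omega
        rw [descSet_append]
        simp only [show n + 1 - k + k = n + 1 by omega, true_and]
        by_cases hc : n - (u (Fin.last n)).val < k
        · rw [if_pos (show n + 1 - k ≤ (u (Fin.last n)).val by omega)]
          simp only [hc, true_and, Finset.insert_subset_iff, Finset.card_insert_of_notMem hnot,
            show ¬ k ≤ n - (u (Fin.last n)).val by omega, false_and, if_false, zero_add]
          by_cases hT : n + 1 ∈ T <;> by_cases hd : descSet u ⊆ T <;> simp [hT, hd, pow_succ']
        · rw [if_neg (show ¬ n + 1 - k ≤ (u (Fin.last n)).val by omega)]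
          simp only [hc, show k ≤ n - (u (Fin.last n)).val by omega, false_and, if_false, true_and]
          simp
      · intro v _ hv
        rw [if_neg]
        rintro ⟨h, -⟩
        apply hv
        ext
        simp only
        omega
      · simp
    rw [Finset.sum_congr rfl fun u _ => hv u, Finset.sum_add_distrib]
    congr 1
    by_cases hT : n + 1 ∈ T
    · simp only [hT, if_true, Finset.mul_sum]
    · simp [hT]

lemma Apoly_eq (T : Finset ℕ) (n : ℕ) : Apoly n T = Qp T n 0 := by
  cases n with
  | zero =>
    simp [Apoly, Qp, descSet]
  | succ n =>
    have h1 : Qp T (n + 1) 0 = ∑ j ∈ (Finset.range (n + 1)).filter (fun _ => True), Rp T n j := by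
      rw [Qp]
      simp
      exact Finset.sum_congr rfl fun j hj => (Rp_eq T n j (by simp at hj; omega)).symm
    rw [h1, sum_Rp, Apoly, Finset.sum_filter]
    simp

lemma av_insert_top (S : Finset ℕ) (m : ℕ) (hm : 1 ≤ m) (h : m ∉ S) :
    av (insert m S) m 0 = av S m 0 := by
  obtain ⟨m, rfl⟩ : ∃ m', m = m' + 1 := ⟨m - 1, by omega⟩
  rw [av, av, if_pos (Finset.mem_insert_self _ _), if_neg h]
  simp only [Nat.zero_le, Finset.filter_true]
  refine Finset.sum_congr rfl fun j _ => av_congr _ _ _ (fun i _ h2 => ?_) _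
  simp; omega

section poset

variable {P : Type*} [Fintype P] [PartialOrder P] [OrderBot P] {ρ : P → ℕ}

lemma rank_eq (hsimp : ∀ y : P, Nonempty ((Set.Icc (⊥ : P) y) ≃o Finset (Fin (ρ y))))
    (y : P) (e : (Set.Icc (⊥ : P) y) ≃o Finset (Fin (ρ y))) (z : Set.Icc (⊥ : P) y) :
    ρ z.1 = (e z).card := by
  obtain ⟨e'⟩ := hsimp z.1
  have h1 : Nat.card (Set.Icc (⊥ : P) z.1) = 2 ^ ρ z.1 := by
    rw [Nat.card_congr e'.toEquiv]; simp
  have h2 : Nat.card (Set.Icc (⊥ : P) z.1) = 2 ^ (e z).card := by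
    let E : Set.Icc (⊥ : P) z.1 ≃ ↥((e z).powerset) :=
      { toFun := fun x => ⟨e ⟨x.1, ⟨bot_le, x.2.2.trans z.2.2⟩⟩, by
          rw [Finset.mem_powerset]
          exact e.le_iff_le.2 x.2.2⟩
        invFun := fun s => ⟨(e.symm s.1).1, ⟨bot_le, by
          have h : s.1 ≤ e z := Finset.mem_powerset.1 s.2
          exact (e.symm_apply_le).2 h⟩⟩
        left_inv := fun x => by simp
        right_inv := fun s => Subtype.ext (e.apply_symm_apply _) }
    rw [Nat.card_congr E, Nat.card_eq_fintype_card, Fintype.card_coe, Finset.card_powerset]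
  exact Nat.pow_right_injective le_rfl (h1.symm.trans h2)

lemma rank_strictMono (hsimp : ∀ y : P, Nonempty ((Set.Icc (⊥ : P) y) ≃o Finset (Fin (ρ y)))) :
    StrictMono ρ := by
  intro x y hxy
  obtain ⟨e⟩ := hsimp y
  have h1 := rank_eq hsimp y e ⟨x, bot_le, hxy.le⟩
  have h2 := rank_eq hsimp y e ⟨y, bot_le, le_rfl⟩
  simp only at h1 h2
  have h3 : (e ⟨x, bot_le, hxy.le⟩).card < (e ⟨y, bot_le, le_rfl⟩).card :=
    Finset.card_lt_card (e.lt_iff_lt.2 hxy)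
  omega

lemma rank_count (hsimp : ∀ y : P, Nonempty ((Set.Icc (⊥ : P) y) ≃o Finset (Fin (ρ y))))
    (y : P) (s : ℕ) :
    (Finset.univ.filter (fun z : P => z ≤ y ∧ ρ z = s)).card = (ρ y).choose s := by
  obtain ⟨e⟩ := hsimp y
  have : (Finset.powersetCard s (Finset.univ : Finset (Fin (ρ y)))).card = (ρ y).choose s := by
    simp
  rw [← this]
  symm
  refine Finset.card_bij (fun t _ => (e.symm t).1) ?_ ?_ ?_
  · intro t ht
    rw [Finset.mem_powersetCard] at ht
    simp only [Finset.mem_filter, Finset.mem_univ, true_and]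
    refine ⟨(e.symm t).2.2, ?_⟩
    rw [rank_eq hsimp y e]; simp [ht.2]
  · intro t _ t' _ h
    exact e.symm.injective (Subtype.ext h)
  · intro z hz
    simp only [Finset.mem_filter, Finset.mem_univ, true_and] at hz
    refine ⟨e ⟨z, bot_le, hz.1⟩, ?_, by simp⟩
    rw [Finset.mem_powersetCard]
    exact ⟨Finset.subset_univ _, by rw [← rank_eq hsimp y e]; exact hz.2⟩

lemma rank_interp (hsimp : ∀ y : P, Nonempty ((Set.Icc (⊥ : P) y) ≃o Finset (Fin (ρ y))))
    (x y : P) (hxy : x ≤ y) (s : ℕ) (h1 : ρ x ≤ s) (h2 : s ≤ ρ y) :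
    ∃ z, x ≤ z ∧ z ≤ y ∧ ρ z = s := by
  obtain ⟨e⟩ := hsimp y
  have h3 := rank_eq hsimp y e ⟨x, bot_le, hxy⟩
  simp only at h3
  obtain ⟨u, hu1, -, hu3⟩ := Finset.exists_subsuperset_card_eq (n := s)
    (Finset.subset_univ (e ⟨x, bot_le, hxy⟩)) (by omega) (by simpa using h2)
  refine ⟨(e.symm u).1, ?_, (e.symm u).2.2, ?_⟩
  · have : (⟨x, bot_le, hxy⟩ : Set.Icc (⊥ : P) y) ≤ e.symm u := by
      rw [e.le_symm_apply]; exact hu1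
    exact this
  · rw [rank_eq hsimp y e]; simp [hu3]

/-- number of chains with rank set `S` in the subset `U`. -/
def cc (ρ : P → ℕ) (U : P → Prop) (S : Finset ℕ) : ℕ :=
  (Finset.univ.filter (fun D : Finset P =>
    IsChain (· ≤ ·) (D : Set P) ∧ D.image ρ = S ∧ ∀ z ∈ D, U z)).card

lemma chain_lt (hm : StrictMono ρ) {D : Set P} (hD : IsChain (· ≤ ·) D) {x y : P} (hx : x ∈ D)
    (hy : y ∈ D) (h : ρ x < ρ y) : x < y := by
  rcases hD.total hx hy with h1 | h1
  · exact lt_of_le_of_ne h1 (by rintro rfl; omega)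
  · have := hm.monotone h1; omega

lemma chain_injOn (hm : StrictMono ρ) {D : Set P} (hD : IsChain (· ≤ ·) D) : Set.InjOn ρ D := by
  intro x hx y hy h
  by_contra hne
  rcases hD.total hx hy with h1 | h1
  · have := hm (lt_of_le_of_ne h1 hne); omega
  · have := hm (lt_of_le_of_ne h1 (Ne.symm hne)); omega

lemma cc_empty (U : P → Prop) : cc ρ U ∅ = 1 := by
  unfold cc
  rw [Finset.card_eq_one]
  refine ⟨∅, ?_⟩
  ext D
  simp only [Finset.mem_filter, Finset.mem_univ, true_and, Finset.mem_singleton,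
    Finset.image_eq_empty]
  constructor
  · exact fun h => h.2.1
  · rintro rfl; simp

lemma cc_insert (hm : StrictMono ρ) (U : P → Prop) (hU : ∀ x y, x ≤ y → U y → U x) (S : Finset ℕ)
    (m : ℕ) (hS : ∀ i ∈ S, i < m) :
    cc ρ U (insert m S) =
      ∑ z ∈ Finset.univ.filter (fun z : P => U z ∧ ρ z = m), cc ρ (fun x => x < z) S := by
  unfold cc
  rw [← Finset.card_sigma]
  symm
  have hlt : ∀ D : Finset P, D.image ρ = S → ∀ z ∈ D, ρ z < m := by
    intro D hD z hz
    apply hS; rw [← hD]; exact Finset.mem_image_of_mem _ hz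
  have herase : ∀ (z : P) (D : Finset P), ρ z = m → D.image ρ = S →
      (insert z D).filter (fun x => ρ x < m) = D := by
    intro z D h1 h2
    ext x
    simp only [Finset.mem_filter, Finset.mem_insert]
    constructor
    · rintro ⟨rfl | h, h3⟩
      · omega
      · exact h
    · intro h; exact ⟨Or.inr h, hlt D h2 x h⟩
  refine Finset.card_bij (fun x _ => insert x.1 x.2) ?_ ?_ ?_
  · rintro ⟨z, D⟩ h
    simp only [Finset.mem_sigma, Finset.mem_filter, Finset.mem_univ, true_and] at h ⊢
    obtain ⟨⟨h1, h2⟩, h3, h4, h5⟩ := h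
    refine ⟨?_, ?_, ?_⟩
    · rw [Finset.coe_insert]
      exact h3.insert fun b hb _ => Or.inr (h5 b hb).le
    · rw [Finset.image_insert, h2, h4]
    · intro x hx
      rcases Finset.mem_insert.1 hx with rfl | hx
      · exact h1
      · exact hU _ _ (h5 x hx).le h1
  · rintro ⟨z, D⟩ h ⟨z', D'⟩ h' heq
    simp only [Finset.mem_sigma, Finset.mem_filter, Finset.mem_univ, true_and] at h h' heq
    obtain ⟨⟨h1, h2⟩, h3, h4, h5⟩ := h
    obtain ⟨⟨h1', h2'⟩, h3', h4', h5'⟩ := h'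
    have e1 : D = D' := by rw [← herase z D h2 h4, heq, herase z' D' h2' h4']
    have e2 : z = z' := by
      have : z ∈ insert z' D' := heq ▸ Finset.mem_insert_self _ _
      rcases Finset.mem_insert.1 this with h | h
      · exact h
      · have := hlt D' h4' z h; omega
    subst e1; subst e2; rfl
  · intro D hD
    simp only [Finset.mem_filter, Finset.mem_univ, true_and] at hD
    obtain ⟨h1, h2, h3⟩ := hD
    have hmem : m ∈ D.image ρ := by rw [h2]; exact Finset.mem_insert_self _ _
    obtain ⟨z, hz, hzm⟩ := Finset.mem_image.1 hmem
    have hne : ∀ x ∈ D.erase z, ρ x ∈ S ∧ x < z := by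
      intro x hx
      rw [Finset.mem_erase] at hx
      have h4 : ρ x ∈ insert m S := by rw [← h2]; exact Finset.mem_image_of_mem _ hx.2
      have h5 : ρ x ≠ m := fun h => hx.1 (chain_injOn hm h1 hx.2 hz (h.trans hzm.symm))
      have h6 : ρ x ∈ S := (Finset.mem_insert.1 h4).resolve_left h5
      exact ⟨h6, chain_lt hm h1 hx.2 hz (by rw [hzm]; exact hS _ h6)⟩
    refine ⟨⟨z, D.erase z⟩, ?_, Finset.insert_erase hz⟩
    simp only [Finset.mem_sigma, Finset.mem_filter, Finset.mem_univ, true_and]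
    refine ⟨⟨h3 z hz, hzm⟩, h1.mono (by simp), ?_, fun x hx => (hne x hx).2⟩
    ext i
    constructor
    · intro hi
      obtain ⟨x, hx, rfl⟩ := Finset.mem_image.1 hi
      exact (hne x hx).1
    · intro hi
      have : i ∈ D.image ρ := by rw [h2]; exact Finset.mem_insert_of_mem hi
      obtain ⟨x, hx, rfl⟩ := Finset.mem_image.1 this
      refine Finset.mem_image_of_mem _ (Finset.mem_erase.2 ⟨?_, hx⟩)
      rintro rfl
      have := hS _ hi; omega

lemma cc_below (hsimp : ∀ y : P, Nonempty ((Set.Icc (⊥ : P) y) ≃o Finset (Fin (ρ y))))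
    (S : Finset ℕ) : ∀ y : P, (∀ i ∈ S, 1 ≤ i ∧ i < ρ y) →
      cc ρ (fun x => x < y) S = av S (ρ y) 0 := by
  have hm := rank_strictMono hsimp
  induction S using Finset.induction_on_max with
  | empty =>
    intro y _
    rw [cc_empty]
    have := av_closed ∅ 0 (Or.inr rfl) (ρ y) (by simp) 0 (by omega)
    simp only [zero_add] at this
    rw [this]; simp [av]
  | insert m S hS ih =>
    intro y hy
    have hmy := hy m (Finset.mem_insert_self _ _)
    rw [cc_insert hm _ (fun a b hab hb => lt_of_le_of_lt hab hb) S m hS]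
    have h1 : ∀ z ∈ Finset.univ.filter (fun z : P => z < y ∧ ρ z = m),
        cc ρ (fun x => x < z) S = av S m 0 := by
      intro z hz
      simp only [Finset.mem_filter, Finset.mem_univ, true_and] at hz
      rw [ih z, hz.2]
      intro i hi
      exact ⟨(hy i (Finset.mem_insert_of_mem hi)).1, hz.2 ▸ hS i hi⟩
    rw [Finset.sum_congr rfl h1, Finset.sum_const, smul_eq_mul]
    have h2 : Finset.univ.filter (fun z : P => z < y ∧ ρ z = m) =
        Finset.univ.filter (fun z : P => z ≤ y ∧ ρ z = m) := by
      ext z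
      simp only [Finset.mem_filter, Finset.mem_univ, true_and]
      constructor
      · exact fun h => ⟨h.1.le, h.2⟩
      · exact fun h => ⟨lt_of_le_of_ne h.1 (by rintro rfl; omega), h.2⟩
    rw [h2, rank_count hsimp]
    have h3 := av_closed (insert m S) m (Or.inl (Finset.mem_insert_self _ _)) (ρ y - m)
      (fun i h1 _ h => by
        rcases Finset.mem_insert.1 h with h | h
        · omega
        · have := hS i h; omega) 0 (by omega)
    rw [show m + (ρ y - m) = ρ y by omega] at h3
    rw [h3, av_insert_top _ _ hmy.1 (fun h => lt_irrefl _ (hS m h)), Nat.sub_zero,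
      Nat.choose_symm hmy.2.le]

/-- the number of elements of rank `m` -/
def fr (ρ : P → ℕ) (m : ℕ) : ℕ := (Finset.univ.filter (fun y : P => ρ y = m)).card

lemma f_eq_h (n m : ℕ) (hm : m ≤ n) :
    (fr ρ m : ℝ) = ∑ k ∈ Finset.range (n + 1),
      ((hpolyP P ρ n).coeff k : ℝ) * ((n - k).choose (n - m) : ℕ) := by
  set H : Polynomial ℝ := (hpolyP P ρ n).map (Int.castRingHom ℝ) with hH
  have hHs : H = ∑ i ∈ Finset.range (n + 1), C (fr ρ i : ℝ) * X ^ i * (1 - X) ^ (n - i) := by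
    rw [hH, hpolyP, Polynomial.map_sum]
    refine Finset.sum_congr rfl fun i _ => ?_
    simp [fr]
  have hdeg : H.natDegree < n + 1 := by
    rw [hHs, Nat.lt_succ_iff]
    refine natDegree_sum_le_of_forall_le _ _ fun i hi => ?_
    have hi' : i ≤ n := by simp at hi; omega
    have h1 : (1 - X : Polynomial ℝ).natDegree ≤ 1 := by
      refine (natDegree_sub_le _ _).trans ?_
      simp
    have h2 := natDegree_mul_le (p := C (fr ρ i : ℝ) * X ^ i) (q := (1 - X) ^ (n - i))
    have h3 := natDegree_C_mul_X_pow_le (fr ρ i : ℝ) i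
    have h4 := natDegree_pow_le_of_le (n - i) h1
    omega
  have hcoeff : ∀ k, H.coeff k = ((hpolyP P ρ n).coeff k : ℝ) := by
    intro k; rw [hH, coeff_map]; rfl
  have key : (∑ i ∈ Finset.range (n + 1), C (fr ρ i : ℝ) * X ^ i) =
      ∑ k ∈ Finset.range (n + 1), C (H.coeff k) * (X ^ k * (1 + X) ^ (n - k)) := by
    apply Polynomial.eq_of_infinite_eval_eq
    apply (Set.Ioi_infinite (0 : ℝ)).mono
    intro y hy
    have hy : 0 < y := hy
    have hy1 : (1 + y) ≠ 0 := by positivity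
    simp only [Set.mem_ofPred_eq, eval_finsetSum, eval_mul, eval_C, eval_pow, eval_X, eval_add,
      eval_one]
    have e1 : H.eval (y / (1 + y)) * (1 + y) ^ n = ∑ k ∈ Finset.range (n + 1),
        H.coeff k * (y ^ k * (1 + y) ^ (n - k)) := by
      rw [eval_eq_sum_range' hdeg, Finset.sum_mul]
      refine Finset.sum_congr rfl fun k hk => ?_
      have hk' : k ≤ n := by simp at hk; omega
      rw [div_pow, ← pow_sub_mul_pow (1 + y) hk']
      field_simp
    have e2 : H.eval (y / (1 + y)) * (1 + y) ^ n = ∑ i ∈ Finset.range (n + 1),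
        (fr ρ i : ℝ) * y ^ i := by
      conv_lhs => rw [hHs]
      simp only [eval_finsetSum, eval_mul, eval_C, eval_pow, eval_X, eval_sub,
        eval_one]
      rw [Finset.sum_mul]
      refine Finset.sum_congr rfl fun k hk => ?_
      have hk' : k ≤ n := by simp at hk; omega
      have : 1 - y / (1 + y) = 1 / (1 + y) := by field_simp; ring
      rw [this, div_pow, div_pow, one_pow, ← pow_sub_mul_pow (1 + y) hk']
      field_simp
    rw [← e1, ← e2]
  have := congrArg (fun p => coeff p m) key
  simp only [finsetSum_coeff, coeff_C_mul, coeff_X_pow] at this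
  rw [Finset.sum_eq_single m] at this
  · rw [if_pos rfl, mul_one] at this
    rw [this]
    refine Finset.sum_congr rfl fun k hk => ?_
    have hk' : k ≤ n := by simp at hk; omega
    rw [hcoeff, coeff_X_pow_mul']
    congr 1
    split_ifs with h
    · rw [coeff_one_add_X_pow]
      congr 1
      rw [← Nat.choose_symm (by omega)]
      congr 1; omega
    · rw [Nat.choose_eq_zero_of_lt (by omega)]; simp
  · intro b _ hb; rw [if_neg (Ne.symm hb), mul_zero]
  · intro h; exact absurd (Finset.mem_range.2 (by omega)) h

lemma fr_zero (hm : StrictMono ρ) (hbot : ρ ⊥ = 0) : fr ρ 0 = 1 := by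
  unfold fr
  rw [Finset.card_eq_one]
  refine ⟨⊥, ?_⟩
  ext y
  simp only [Finset.mem_filter, Finset.mem_univ, true_and, Finset.mem_singleton]
  constructor
  · intro h
    by_contra hne
    have := hm (bot_lt_iff_ne_bot.2 hne); omega
  · rintro rfl; exact hbot

lemma cc_all (hsimp : ∀ y : P, Nonempty ((Set.Icc (⊥ : P) y) ≃o Finset (Fin (ρ y))))
    (hbot : ρ ⊥ = 0) (n : ℕ) (S : Finset ℕ) (hS : S ⊆ Finset.Icc 1 n) :
    (cc ρ (fun _ => True) S : ℝ) = ∑ k ∈ Finset.range (n + 1),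
      ((hpolyP P ρ n).coeff k : ℝ) * (av S n k : ℝ) := by
  have hm := rank_strictMono hsimp
  have main : ∀ m, m ≤ n → (m ∈ S ∨ m = 0) → (∀ i ∈ S, i ≤ m) →
      cc ρ (fun _ => True) S = fr ρ m * av S m 0 →
      (cc ρ (fun _ => True) S : ℝ) = ∑ k ∈ Finset.range (n + 1),
      ((hpolyP P ρ n).coeff k : ℝ) * (av S n k : ℝ) := by
    intro m hmn h1 h2 h3
    rw [h3, Nat.cast_mul, f_eq_h n m hmn, Finset.sum_mul]
    refine Finset.sum_congr rfl fun k hk => ?_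
    have hk' : k ≤ n := by simp at hk; omega
    have := av_closed S m h1 (n - m) (fun i h4 _ h5 => by have := h2 i h5; omega) k (by omega)
    rw [show m + (n - m) = n by omega] at this
    rw [this, Nat.cast_mul]
    ring
  induction S using Finset.induction_on_max with
  | empty =>
    refine main 0 (Nat.zero_le _) (Or.inr rfl) (by simp) ?_
    rw [cc_empty, fr_zero hm hbot]; simp [av]
  | insert m S hSm _ =>
    have hmn := Finset.mem_Icc.1 (hS (Finset.mem_insert_self _ _))
    refine main m hmn.2 (Or.inl (Finset.mem_insert_self _ _)) ?_ ?_
    · intro i hi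
      rcases Finset.mem_insert.1 hi with h | h
      · exact h.le
      · exact (hSm i h).le
    · rw [cc_insert hm _ (fun _ _ _ _ => trivial) S m hSm]
      simp only [true_and]
      have h1 : ∀ z ∈ Finset.univ.filter (fun z : P => ρ z = m),
          cc ρ (fun x => x < z) S = av S m 0 := by
        intro z hz
        simp only [Finset.mem_filter, Finset.mem_univ, true_and] at hz
        rw [cc_below hsimp, hz]
        intro i hi
        exact ⟨(Finset.mem_Icc.1 (hS (Finset.mem_insert_of_mem hi))).1, hz ▸ hSm i hi⟩
      rw [Finset.sum_congr rfl h1, Finset.sum_const, smul_eq_mul,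
        av_insert_top _ _ hmn.1 (fun h => lt_irrefl _ (hSm m h))]
      rfl

end poset

lemma beta_sum (a : Finset ℕ → ℤ) (T : Finset ℕ) :
    (∑ S ∈ T.powerset, C (((∑ R ∈ S.powerset, (-1 : ℤ) ^ (S.card - R.card) * a R : ℤ) : ℝ)) *
      X ^ S.card : Polynomial ℝ) =
    ∑ R ∈ T.powerset, C (a R : ℝ) * (X ^ R.card * (1 - X) ^ (T.card - R.card)) := by
  have h1 : ∀ S ∈ T.powerset,
      (C (((∑ R ∈ S.powerset, (-1 : ℤ) ^ (S.card - R.card) * a R : ℤ) : ℝ)) *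
      X ^ S.card : Polynomial ℝ) =
      ∑ R ∈ S.powerset, C (a R : ℝ) * ((-1) ^ (S.card - R.card) * X ^ S.card) := by
    intro S _
    rw [Int.cast_sum, map_sum, Finset.sum_mul]
    refine Finset.sum_congr rfl fun R _ => ?_
    simp only [Int.cast_mul, Int.cast_pow, Int.cast_neg, Int.cast_one, map_mul, map_pow, map_neg,
      map_one]
    ring
  rw [Finset.sum_congr rfl h1]
  rw [Finset.sum_comm' (t' := T.powerset) (s' := fun R => Finset.Icc R T)]
  · refine Finset.sum_congr rfl fun R hR => ?_
    have hR' := Finset.mem_powerset.1 hR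
    rw [← Finset.mul_sum]
    congr 1
    rw [Finset.Icc_eq_image_powerset hR', Finset.sum_image]
    · have h2 : ∀ U ∈ (T \ R).powerset,
          ((-1) ^ ((R ∪ U).card - R.card) * X ^ (R ∪ U).card : Polynomial ℝ) =
          X ^ R.card * ((-X) ^ U.card * 1 ^ ((T \ R).card - U.card)) := by
        intro U hU
        have hd : Disjoint R U :=
          Finset.disjoint_of_subset_right (Finset.mem_powerset.1 hU) Finset.disjoint_sdiff
        rw [Finset.card_union_of_disjoint hd, Nat.add_sub_cancel_left, pow_add, one_pow,
          neg_pow (X : Polynomial ℝ)]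
        ring
      rw [Finset.sum_congr rfl h2, ← Finset.mul_sum, Finset.sum_pow_mul_eq_add_pow,
        Finset.card_sdiff_of_subset hR']
      ring
    · intro U hU V hV h
      have hd : ∀ U ∈ (T \ R).powerset, (R ∪ U) \ R = U := by
        intro U hU
        rw [Finset.union_sdiff_left]
        exact Finset.sdiff_eq_self_of_disjoint
          (Finset.disjoint_of_subset_left (Finset.mem_powerset.1 hU) Finset.sdiff_disjoint)
      have h' : R ∪ U = R ∪ V := h
      rw [← hd U hU, h', hd V hV]
  · intro S R
    simp only [Finset.mem_powerset, Finset.mem_Icc]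
    constructor
    · rintro ⟨h1, h2⟩; exact ⟨⟨h2, h1⟩, h2.trans h1⟩
    · rintro ⟨⟨h1, h2⟩, h3⟩; exact ⟨h2, h1⟩

section poset2

variable {P : Type*} [Fintype P] [PartialOrder P] [OrderBot P] {ρ : P → ℕ}

lemma chain_interp (hsimp : ∀ y : P, Nonempty ((Set.Icc (⊥ : P) y) ≃o Finset (Fin (ρ y))))
    (hbot : ρ ⊥ = 0) (n : ℕ) (hmax : ∀ x : P, IsMax x → ρ x = n)
    (D : Finset P) (hD : IsChain (· ≤ ·) (D : Set P)) (s : ℕ) (hs : s ≤ n)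
    (hns : ∀ c ∈ D, ρ c ≠ s) :
    ∃ z, ρ z = s ∧ IsChain (· ≤ ·) ((insert z D : Finset P) : Set P) := by
  have hm := rank_strictMono hsimp
  -- lower bound
  obtain ⟨x, hxs, hxl, hxD⟩ : ∃ x, ρ x ≤ s ∧ (∀ c ∈ D, ρ c < s → c ≤ x) ∧ (x = ⊥ ∨ x ∈ D) := by
    by_cases hne : (D.filter (fun c => ρ c < s)).Nonempty
    · obtain ⟨x, hx, hx2⟩ := Finset.exists_max_image _ ρ hne
      rw [Finset.mem_filter] at hx
      refine ⟨x, hx.2.le, fun c hc hcs => ?_, Or.inr hx.1⟩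
      have h1 := hx2 c (Finset.mem_filter.2 ⟨hc, hcs⟩)
      rcases h1.lt_or_eq with h | h
      · exact (chain_lt hm hD hc hx.1 h).le
      · exact (chain_injOn hm hD hc hx.1 h).le
    · refine ⟨⊥, by omega, fun c hc hcs => ?_, Or.inl rfl⟩
      exact absurd ⟨c, Finset.mem_filter.2 ⟨hc, hcs⟩⟩ hne
  obtain ⟨y, hxy, hys, hyl⟩ : ∃ y, x ≤ y ∧ s ≤ ρ y ∧ (∀ c ∈ D, s < ρ c → y ≤ c) := by
    by_cases hne : (D.filter (fun c => s < ρ c)).Nonempty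
    · obtain ⟨y, hy, hy2⟩ := Finset.exists_min_image _ ρ hne
      rw [Finset.mem_filter] at hy
      refine ⟨y, ?_, hy.2.le, fun c hc hcs => ?_⟩
      · rcases hxD with rfl | hxD
        · exact bot_le
        · exact (chain_lt hm hD hxD hy.1 (by omega)).le
      · have h1 := hy2 c (Finset.mem_filter.2 ⟨hc, hcs⟩)
        rcases h1.lt_or_eq with h | h
        · exact (chain_lt hm hD hy.1 hc h).le
        · exact (chain_injOn hm hD hy.1 hc h).le
    · obtain ⟨y, hxy, hy⟩ := Finite.exists_le_maximal (p := fun _ : P => True) (a := x) trivial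
      refine ⟨y, hxy, ?_, fun c hc hcs => ?_⟩
      · rw [hmax y (fun b hb => hy.2 trivial hb)]; exact hs
      · exact absurd ⟨c, Finset.mem_filter.2 ⟨hc, hcs⟩⟩ hne
  obtain ⟨z, h1, h2, h3⟩ := rank_interp hsimp x y hxy s hxs hys
  refine ⟨z, h3, ?_⟩
  rw [Finset.coe_insert]
  refine hD.insert fun c hc _ => ?_
  rcases lt_or_gt_of_ne (hns c hc) with h | h
  · exact Or.inr ((hxl c hc h).trans h1)
  · exact Or.inl (h2.trans (hyl c hc h))

/-- the subset of `P̂_T` determined by a finset of `P` and the presence of `1̂`, `0̂`. -/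
def Phi (ρ : P → ℕ) (T : Finset ℕ) (e1 e2 : Bool) (D : Finset P) : Set ↥(rankSel P ρ T) :=
  {q | (q.1 = ⊤ ∧ e1 = true) ∨ (q.1 = ((⊥ : P) : WithTop P) ∧ e2 = true) ∨
    ∃ y ∈ D, q.1 = (y : WithTop P)}

lemma Phi_top (T : Finset ℕ) (e1 e2 : Bool) (D : Finset P) :
    (⟨⊤, Or.inl rfl⟩ : ↥(rankSel P ρ T)) ∈ Phi ρ T e1 e2 D ↔ e1 = true := by
  simp [Phi]

lemma Phi_bot (T : Finset ℕ) (e1 e2 : Bool) (D : Finset P) (hD : ⊥ ∉ D) :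
    (⟨((⊥ : P) : WithTop P), Or.inr (Or.inl rfl)⟩ : ↥(rankSel P ρ T)) ∈ Phi ρ T e1 e2 D ↔
      e2 = true := by
  simp only [Phi, Set.mem_ofPred_eq, WithTop.coe_ne_top, false_and, false_or, true_and,
    WithTop.coe_inj, or_iff_left_iff_imp]
  rintro ⟨y, hy, rfl⟩
  exact absurd hy hD

lemma Phi_mid (T : Finset ℕ) (e1 e2 : Bool) (D : Finset P) (y : P) (hy : ρ y ∈ T) (hb : y ≠ ⊥) :
    (⟨(y : WithTop P), Or.inr (Or.inr ⟨y, rfl, hy⟩)⟩ : ↥(rankSel P ρ T)) ∈ Phi ρ T e1 e2 D ↔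
      y ∈ D := by
  simp only [Phi, Set.mem_ofPred_eq, WithTop.coe_ne_top, false_and, false_or,
    WithTop.coe_inj, hb]
  simp

lemma Phi_chain (T : Finset ℕ) (e1 e2 : Bool) (D : Finset P)
    (hD : IsChain (· ≤ ·) (D : Set P)) : IsChain (· ≤ ·) (Phi ρ T e1 e2 D) := by
  rintro ⟨q, hq⟩ h1 ⟨r, hr⟩ h2 _
  simp only [Phi, Set.mem_ofPred_eq] at h1 h2
  simp only [Subtype.mk_le_mk]
  rcases h1 with ⟨rfl, _⟩ | ⟨rfl, _⟩ | ⟨y, hy, rfl⟩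
  · exact Or.inr le_top
  · left; exact bot_le
  · rcases h2 with ⟨rfl, _⟩ | ⟨rfl, _⟩ | ⟨z, hz, rfl⟩
    · exact Or.inl le_top
    · right; exact bot_le
    · simp only [WithTop.coe_le_coe]
      exact hD.total hy hz

lemma chain_of_Phi (T : Finset ℕ) (e1 e2 : Bool) (D : Finset P) (hT : ∀ y ∈ D, ρ y ∈ T)
    (h : IsChain (· ≤ ·) (Phi ρ T e1 e2 D)) : IsChain (· ≤ ·) (D : Set P) := by
  intro y hy z hz _
  have h1 := h.total (x := ⟨(y : WithTop P), Or.inr (Or.inr ⟨y, rfl, hT y hy⟩)⟩)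
    (y := ⟨(z : WithTop P), Or.inr (Or.inr ⟨z, rfl, hT z hz⟩)⟩)
    (Or.inr (Or.inr ⟨y, hy, rfl⟩)) (Or.inr (Or.inr ⟨z, hz, rfl⟩))
  rcases h1 with h1 | h1
  · exact Or.inl (WithTop.coe_le_coe.1 h1)
  · exact Or.inr (WithTop.coe_le_coe.1 h1)

lemma Phi_surj (hbot : ρ ⊥ = 0) (T : Finset ℕ) (h0 : 0 ∉ T) (Q : Set ↥(rankSel P ρ T)) :
    ∃ e1 e2 D, (∀ y ∈ D, ρ y ∈ T) ∧ Q = Phi ρ T e1 e2 D := by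
  refine ⟨decide ((⟨⊤, Or.inl rfl⟩ : ↥(rankSel P ρ T)) ∈ Q),
    decide ((⟨((⊥ : P) : WithTop P), Or.inr (Or.inl rfl)⟩ : ↥(rankSel P ρ T)) ∈ Q),
    Finset.univ.filter (fun y => ∃ h : ρ y ∈ T,
      (⟨(y : WithTop P), Or.inr (Or.inr ⟨y, rfl, h⟩)⟩ : ↥(rankSel P ρ T)) ∈ Q), ?_, ?_⟩
  · intro y hy
    exact (Finset.mem_filter.1 hy).2.1
  · ext ⟨q, hq⟩
    have hq' := hq
    rcases hq' with rfl | rfl | ⟨y, rfl, hy⟩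
    · rw [Phi_top]; simp
    · rw [Phi_bot]
      · simp
      · simp [hbot, h0]
    · rw [Phi_mid _ _ _ _ y hy (by rintro rfl; exact h0 (hbot ▸ hy))]
      simp [hy]

lemma bot_notMem (hbot : ρ ⊥ = 0) {T : Finset ℕ} (h0 : 0 ∉ T) {D : Finset P}
    (hT : ∀ y ∈ D, ρ y ∈ T) : ⊥ ∉ D := fun h => h0 (hbot ▸ hT _ h)

lemma Phi_inj (hbot : ρ ⊥ = 0) (T : Finset ℕ) (h0 : 0 ∉ T) (e1 e2 e1' e2' : Bool)
    (D D' : Finset P) (hT : ∀ y ∈ D, ρ y ∈ T) (hT' : ∀ y ∈ D', ρ y ∈ T)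
    (h : Phi ρ T e1 e2 D = Phi ρ T e1' e2' D') : e1 = e1' ∧ e2 = e2' ∧ D = D' := by
  refine ⟨?_, ?_, ?_⟩
  · rw [Bool.eq_iff_iff, ← Phi_top (ρ := ρ) T e1 e2 D, h, Phi_top]
  · rw [Bool.eq_iff_iff, ← Phi_bot (ρ := ρ) T e1 e2 D (bot_notMem hbot h0 hT), h,
      Phi_bot _ _ _ _ (bot_notMem hbot h0 hT')]
  · ext y
    by_cases hy : ρ y ∈ T
    · have hb : y ≠ ⊥ := by rintro rfl; exact h0 (hbot ▸ hy)
      rw [← Phi_mid T e1 e2 D y hy hb, h, Phi_mid _ _ _ _ y hy hb]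
    · exact ⟨fun h => absurd (hT y h) hy, fun h => absurd (hT' y h) hy⟩

lemma Phi_card (hbot : ρ ⊥ = 0) (T : Finset ℕ) (h0 : 0 ∉ T) (e1 e2 : Bool)
    (D : Finset P) (hT : ∀ y ∈ D, ρ y ∈ T) :
    (Phi ρ T e1 e2 D).ncard = e1.toNat + e2.toNat + D.card := by
  have hb := bot_notMem hbot h0 hT
  have h1 : Subtype.val '' (Phi ρ T e1 e2 D) =
      (((if e1 = true then {⊤} else ∅) ∪ ((if e2 = true then {((⊥ : P) : WithTop P)} else ∅) ∪
        D.map ⟨WithTop.some, WithTop.coe_injective⟩) : Finset (WithTop P)) : Set (WithTop P)) := by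
    ext q
    simp only [Set.mem_image, Finset.coe_union, Set.mem_union, Finset.mem_coe, Finset.mem_map,
      Function.Embedding.coeFn_mk]
    constructor
    · rintro ⟨q, h | h | ⟨y, hy, h⟩, rfl⟩
      · left; simp [h]
      · right; left; simp [h]
      · right; right; exact ⟨y, hy, h.symm⟩
    · rintro (h | h | ⟨y, hy, rfl⟩)
      · split_ifs at h with he
        · rw [Finset.mem_singleton] at h
          subst h
          exact ⟨⟨⊤, Or.inl rfl⟩, Or.inl ⟨rfl, he⟩, rfl⟩
        · simp at h
      · split_ifs at h with he
        · rw [Finset.mem_singleton] at h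
          subst h
          exact ⟨⟨_, Or.inr (Or.inl rfl)⟩, Or.inr (Or.inl ⟨rfl, he⟩), rfl⟩
        · simp at h
      · exact ⟨⟨_, Or.inr (Or.inr ⟨y, rfl, hT y hy⟩)⟩, Or.inr (Or.inr ⟨y, hy, rfl⟩), rfl⟩
  rw [← Set.ncard_image_of_injective _ Subtype.val_injective, h1, Set.ncard_coe_finset,
    Finset.card_union_of_disjoint, Finset.card_union_of_disjoint, Finset.card_map]
  · cases e1 <;> cases e2 <;> simp <;> omega
  · rw [Finset.disjoint_left]
    intro q hq hq2
    obtain ⟨y, hy, rfl⟩ := Finset.mem_map.1 hq2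
    split_ifs at hq
    · simp only [Function.Embedding.coeFn_mk, Finset.mem_singleton, WithTop.coe_inj] at hq
      exact hb (hq ▸ hy)
    · simp at hq
  · rw [Finset.disjoint_left]
    intro q hq hq2
    split_ifs at hq
    · rw [Finset.mem_singleton] at hq
      subst hq
      rw [Finset.mem_union, Finset.mem_map] at hq2
      rcases hq2 with h | ⟨y, _, h⟩
      · split_ifs at h <;> simp at h
      · simp at h
    · simp at hq

lemma Phi_mono (T : Finset ℕ) (e1 e2 : Bool) (D D' : Finset P) (h : D ⊆ D') :
    Phi ρ T e1 e2 D ⊆ Phi ρ T true true D' := by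
  rintro q (h1 | h1 | ⟨y, hy, h1⟩)
  · exact Or.inl ⟨h1.1, rfl⟩
  · exact Or.inr (Or.inl ⟨h1.1, rfl⟩)
  · exact Or.inr (Or.inr ⟨y, h hy, h1⟩)

lemma alpha_eq (hsimp : ∀ y : P, Nonempty ((Set.Icc (⊥ : P) y) ≃o Finset (Fin (ρ y))))
    (hbot : ρ ⊥ = 0) (n : ℕ) (hmax : ∀ x : P, IsMax x → ρ x = n) (S : Finset ℕ)
    (hS : S ⊆ Finset.Icc 1 n) : alphaP P ρ S = cc ρ (fun _ => True) S := by
  have hm := rank_strictMono hsimp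
  have h0 : 0 ∉ S := fun h => by have := Finset.mem_Icc.1 (hS h); omega
  have him : ∀ D : Finset P, D.image ρ = S → ∀ y ∈ D, ρ y ∈ S := by
    intro D h y hy; rw [← h]; exact Finset.mem_image_of_mem _ hy
  unfold alphaP cc
  have key : {C : Set ↥(rankSel P ρ S) | IsMaxChain (· ≤ ·) C} =
      (fun D => Phi ρ S true true D) '' ((Finset.univ.filter (fun D : Finset P =>
        IsChain (· ≤ ·) (D : Set P) ∧ D.image ρ = S ∧ ∀ z ∈ D, True) : Finset (Finset P)) :
          Set (Finset P)) := by
    ext Q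
    simp only [Set.mem_ofPred_eq, Set.mem_image, Finset.coe_filter, Finset.mem_univ, true_and]
    constructor
    · intro hQ
      obtain ⟨e1, e2, D, hD, rfl⟩ := Phi_surj hbot S h0 Q
      have hch := chain_of_Phi S e1 e2 D hD hQ.1
      have heq := hQ.2 (Phi_chain S true true D hch) (Phi_mono S e1 e2 D D (Finset.Subset.refl _))
      refine ⟨D, ⟨hch, ?_, fun _ _ => trivial⟩, heq.symm⟩
      apply Finset.Subset.antisymm
      · intro i hi
        obtain ⟨y, hy, rfl⟩ := Finset.mem_image.1 hi
        exact hD y hy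
      · intro s hs
        by_contra hns
        obtain ⟨z, hz, hzc⟩ := chain_interp hsimp hbot n hmax D hch s
          (Finset.mem_Icc.1 (hS hs)).2 (fun c hc h => hns (h ▸ Finset.mem_image_of_mem _ hc))
        have heq2 := hQ.2 (Phi_chain S true true _ hzc)
          (Phi_mono S e1 e2 D (insert z D) (Finset.subset_insert _ _))
        have := (Phi_inj hbot S h0 _ _ _ _ D (insert z D) hD (by
          intro y hy
          rcases Finset.mem_insert.1 hy with rfl | hy
          · rw [hz]; exact hs
          · exact hD y hy) heq2).2.2
        have hzD : z ∈ D := by rw [this]; exact Finset.mem_insert_self _ _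
        exact hns (hz ▸ Finset.mem_image_of_mem _ hzD)
    · rintro ⟨D, ⟨h1, h2, -⟩, rfl⟩
      refine ⟨Phi_chain S true true D h1, ?_⟩
      intro Q hQ hsub
      obtain ⟨e1, e2, D', hD', rfl⟩ := Phi_surj hbot S h0 Q
      have hch := chain_of_Phi S e1 e2 D' hD' hQ
      have a1 : e1 = true := (Phi_top S e1 e2 D').1 (hsub ((Phi_top S true true D).2 rfl))
      have a2 : e2 = true := (Phi_bot S e1 e2 D' (bot_notMem hbot h0 hD')).1
        (hsub ((Phi_bot S true true D (bot_notMem hbot h0 (him D h2))).2 rfl))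
      subst a1; subst a2
      have hDD : D ⊆ D' := by
        intro y hy
        have hyS := him D h2 y hy
        have hb : y ≠ ⊥ := by rintro rfl; exact h0 (hbot ▸ hyS)
        exact (Phi_mid S true true D' y hyS hb).1 (hsub ((Phi_mid S true true D y hyS hb).2 hy))
      have : D = D' := by
        refine Finset.Subset.antisymm hDD fun y hy => ?_
        have h3 : ρ y ∈ D.image ρ := by rw [h2]; exact hD' y hy
        obtain ⟨c, hc, hcy⟩ := Finset.mem_image.1 h3
        rw [← chain_injOn hm hch (hDD hc) hy hcy]; exact hc
      rw [this]
  rw [key, Set.InjOn.ncard_image, Set.ncard_coe_finset]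
  · congr
  intro D hD D' hD' h
  simp only [Finset.coe_filter, Finset.mem_univ, true_and, Set.mem_ofPred_eq] at hD hD'
  exact (Phi_inj hbot S h0 _ _ _ _ D D' (him D hD.2.1) (him D' hD'.2.1) h).2.2

lemma chainPoly_eq_sum (Q : Type*) [PartialOrder Q] [Fintype Q] :
    chainPoly Q = ∑ D ∈ Finset.univ.filter (fun D : Set Q => IsChain (· ≤ ·) D),
      (X : Polynomial ℝ) ^ D.ncard := by
  unfold chainPoly
  rw [← Finset.sum_fiberwise_of_maps_to (g := fun D : Set Q => D.ncard)
    (t := Finset.range (Nat.card Q + 1))]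
  · refine Finset.sum_congr rfl fun i _ => ?_
    rw [Finset.filter_filter]
    have : {C : Set Q | IsChain (· ≤ ·) C ∧ C.ncard = i} =
        ((Finset.univ.filter (fun C : Set Q => IsChain (· ≤ ·) C ∧ C.ncard = i) :
          Finset (Set Q)) : Set (Set Q)) := by ext; simp
    rw [this, Set.ncard_coe_finset]
    rw [Finset.sum_congr rfl (g := fun _ => (X : Polynomial ℝ) ^ i)]
    · rw [Finset.sum_const, nsmul_eq_mul]; simp
    · intro D hD
      rw [(Finset.mem_filter.1 hD).2.2]
  · intro D _
    rw [Finset.mem_range, Nat.lt_succ_iff]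
    exact Set.ncard_le_card D

lemma chainPoly_eq (hm : StrictMono ρ) (hbot : ρ ⊥ = 0) (T : Finset ℕ) (h0 : 0 ∉ T) :
    chainPoly ↥(rankSel P ρ T) = (1 + X) ^ 2 *
      ∑ S ∈ T.powerset, C (cc ρ (fun _ => True) S : ℝ) * X ^ S.card := by
  haveI : Finite ↥(rankSel P ρ T) := inferInstance
  haveI : Fintype ↥(rankSel P ρ T) := Fintype.ofFinite _
  rw [chainPoly_eq_sum]
  set F : Finset (Finset P) := Finset.univ.filter
    (fun D : Finset P => IsChain (· ≤ ·) (D : Set P) ∧ ∀ y ∈ D, ρ y ∈ T) with hF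
  have hFm : ∀ D, D ∈ F ↔ IsChain (· ≤ ·) (D : Set P) ∧ ∀ y ∈ D, ρ y ∈ T := by
    intro D; rw [hF]; simp
  have h1 : ∑ x ∈ (Finset.univ : Finset Bool) ×ˢ ((Finset.univ : Finset Bool) ×ˢ F),
      (X : Polynomial ℝ) ^ (x.1.toNat + x.2.1.toNat + x.2.2.card) =
      ∑ D ∈ Finset.univ.filter (fun D : Set ↥(rankSel P ρ T) => IsChain (· ≤ ·) D),
      (X : Polynomial ℝ) ^ D.ncard := by
    refine Finset.sum_bij (fun x _ => Phi ρ T x.1 x.2.1 x.2.2) ?_ ?_ ?_ ?_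
    · rintro ⟨e1, e2, D⟩ h
      simp only [Finset.mem_product, Finset.mem_univ, true_and, hFm] at h
      simp only [Finset.mem_filter, Finset.mem_univ, true_and]
      exact Phi_chain T e1 e2 D h.1
    · rintro ⟨e1, e2, D⟩ h ⟨e1', e2', D'⟩ h' heq
      simp only [Finset.mem_product, Finset.mem_univ, true_and, hFm] at h h' heq
      obtain ⟨rfl, rfl, rfl⟩ := Phi_inj hbot T h0 _ _ _ _ D D' h.2 h'.2 heq
      rfl
    · intro Q hQ
      simp only [Finset.mem_filter, Finset.mem_univ, true_and] at hQ
      obtain ⟨e1, e2, D, hD, rfl⟩ := Phi_surj hbot T h0 Q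
      refine ⟨⟨e1, e2, D⟩, ?_, rfl⟩
      simp only [Finset.mem_product, Finset.mem_univ, true_and, hFm]
      exact ⟨chain_of_Phi T e1 e2 D hD hQ, hD⟩
    · rintro ⟨e1, e2, D⟩ h
      simp only [Finset.mem_product, Finset.mem_univ, true_and, hFm] at h
      rw [Phi_card hbot T h0 e1 e2 D h.2]
  rw [← h1]
  have h2 : ∑ D ∈ F, (X : Polynomial ℝ) ^ D.card =
      ∑ S ∈ T.powerset, C (cc ρ (fun _ => True) S : ℝ) * X ^ S.card := by
    rw [← Finset.sum_fiberwise_of_maps_to (g := fun D : Finset P => D.image ρ)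
      (t := T.powerset)]
    · refine Finset.sum_congr rfl fun S hS => ?_
      rw [Finset.sum_congr rfl (g := fun _ => (X : Polynomial ℝ) ^ S.card)]
      · rw [Finset.sum_const, nsmul_eq_mul]
        have : (F.filter (fun D => D.image ρ = S)).card = cc ρ (fun _ => True) S := by
          unfold cc
          congr 1
          ext D
          simp only [Finset.mem_filter, hFm, Finset.mem_univ, true_and]
          constructor
          · rintro ⟨⟨a, b⟩, c⟩; exact ⟨a, c, fun _ _ => trivial⟩
          · rintro ⟨a, c, -⟩
            refine ⟨⟨a, fun y hy => Finset.mem_powerset.1 hS ?_⟩, c⟩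
            rw [← c]; exact Finset.mem_image_of_mem _ hy
        rw [this]; simp
      · intro D hD
        rw [Finset.mem_filter, hFm] at hD
        rw [← hD.2, Finset.card_image_of_injOn (chain_injOn hm hD.1.1)]
    · intro D hD
      rw [hFm] at hD
      rw [Finset.mem_powerset]
      intro i hi
      obtain ⟨y, hy, rfl⟩ := Finset.mem_image.1 hi
      exact hD.2 y hy
  rw [← h2]
  simp only [Finset.sum_product, Fintype.sum_bool, Bool.toNat_true, Bool.toNat_false, pow_add,
    pow_zero, pow_one, ← Finset.mul_sum]
  ring

end poset2

lemma leading_pos {p : Polynomial ℝ} (h : ∀ i, 0 ≤ p.coeff i) (hp : p ≠ 0) :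
    0 < p.leadingCoeff :=
  lt_of_le_of_ne (h _) (Ne.symm (leadingCoeff_ne_zero.2 hp))

lemma chain_realRooted (T : Finset ℕ) (a : Finset ℕ → ℝ)
    (h : RealRooted (∑ R ∈ T.powerset, C (a R) * (X ^ R.card * (1 - X) ^ (T.card - R.card))))
    (hne : (∑ R ∈ T.powerset, C (a R) * (X ^ R.card * (1 - X) ^ (T.card - R.card))) ≠ 0) :
    RealRooted ((1 + X) ^ 2 * ∑ S ∈ T.powerset, C (a S) * X ^ S.card) := by
  right
  intro z hz
  have h' := h.resolve_left hne
  rw [map_mul, mul_eq_zero] at hz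
  by_cases hz1 : 1 + z = 0
  · have : z = -1 := by linear_combination hz1
    rw [this]; simp
  rcases hz with hz | hz
  · simp at hz; exact absurd hz hz1
  · have hw := h' (z / (1 + z)) (by
      have e : (aeval (z / (1 + z)))
          (∑ R ∈ T.powerset, C (a R) * (X ^ R.card * (1 - X) ^ (T.card - R.card))) *
            (1 + z) ^ T.card = (aeval z) (∑ S ∈ T.powerset, C (a S) * X ^ S.card) := by
        simp only [map_sum, map_mul, map_pow, map_sub, map_one, aeval_X, aeval_C]
        rw [Finset.sum_mul]
        refine Finset.sum_congr rfl fun R hR => ?_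
        have hk := Finset.card_le_card (Finset.mem_powerset.1 hR)
        have : 1 - z / (1 + z) = 1 / (1 + z) := by field_simp; ring
        rw [this, div_pow, div_pow, one_pow, ← pow_sub_mul_pow (1 + z) hk]
        field_simp
      rw [hz] at e
      exact (mul_eq_zero.1 e).resolve_right (pow_ne_zero _ hz1))
    set w := z / (1 + z) with hwd
    have hw1 : w * (1 + z) = z := by rw [hwd]; field_simp
    have hwr : w = (w.re : ℂ) := Complex.ext (by simp) (by simp [hw])
    have hre := congrArg Complex.re hw1
    have him := congrArg Complex.im hw1
    simp [hw] at hre him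
    -- w.re * z.im = z.im
    by_contra hzi
    have h1 : w.re = 1 := by
      have : (w.re - 1) * z.im = 0 := by linarith
      rcases mul_eq_zero.1 this with h | h
      · linarith
      · exact absurd h hzi
    rw [h1] at hre
    linarith

/-- Let `P` be a graded simplicial poset of rank `n` with `h_k(P) ≥ 0` for
all `k` (e.g. `P` Cohen–Macaulay).  Then for every `T ⊆ [n]` the chain polynomial of the
rank-selected subposet `P̂_T` is real-rooted; moreover
`h(Δ(P̂_T), x) := Σ_{S ⊆ T} β_{P̂}(S) x^{|S|}` is real-rooted and is interlaced by
`A^T_n(x)`. -/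
theorem stmt13 (n : ℕ) (P : Type*) [Fintype P] [PartialOrder P] [OrderBot P]
    (ρ : P → ℕ) (hbot : ρ ⊥ = 0) (hcov : ∀ x y : P, x ⋖ y → ρ y = ρ x + 1)
    (hmax : ∀ x : P, IsMax x → ρ x = n)
    (hsimp : ∀ y : P, Nonempty ((Set.Icc (⊥ : P) y) ≃o Finset (Fin (ρ y))))
    (hh : ∀ k : ℕ, 0 ≤ (hpolyP P ρ n).coeff k)
    (T : Finset ℕ) (hT : T ⊆ Finset.Icc 1 n) :
    RealRooted (chainPoly ↥(rankSel P ρ T)) ∧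
    RealRooted (∑ S ∈ T.powerset, C ((betaP P ρ S : ℝ)) * X ^ S.card) ∧
    Interlaces (Apoly n T) (∑ S ∈ T.powerset, C ((betaP P ρ S : ℝ)) * X ^ S.card) := by
  have hm := rank_strictMono hsimp
  have h0 : 0 ∉ T := fun h => by have := Finset.mem_Icc.1 (hT h); omega
  have hTI : T ∩ Finset.Icc 1 n = T := Finset.inter_eq_left.2 hT
  have e1 : (∑ S ∈ T.powerset, C ((betaP P ρ S : ℝ)) * X ^ S.card) =
      ∑ R ∈ T.powerset, C ((cc ρ (fun _ => True) R : ℕ) : ℝ) *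
        (X ^ R.card * (1 - X) ^ (T.card - R.card)) := by
    have := beta_sum (fun R => (alphaP P ρ R : ℤ)) T
    unfold betaP
    rw [this]
    refine Finset.sum_congr rfl fun R hR => ?_
    rw [alpha_eq hsimp hbot n hmax R ((Finset.mem_powerset.1 hR).trans hT)]
    simp
  have e2 : (∑ R ∈ T.powerset, C ((cc ρ (fun _ => True) R : ℕ) : ℝ) *
        (X ^ R.card * (1 - X) ^ (T.card - R.card))) =
      ∑ k ∈ Finset.range (n + 1), C ((hpolyP P ρ n).coeff k : ℝ) * Qp T n k := by
    have h1 : ∀ k ∈ Finset.range (n + 1), C ((hpolyP P ρ n).coeff k : ℝ) * Qp T n k =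
        ∑ R ∈ T.powerset, C (((hpolyP P ρ n).coeff k : ℝ) * (av R n k : ℝ)) *
          (X ^ R.card * (1 - X) ^ (T.card - R.card)) := by
      intro k _
      rw [Qp_eq_sum, hTI, Finset.mul_sum]
      refine Finset.sum_congr rfl fun R _ => ?_
      rw [C_mul, mul_assoc]
    rw [Finset.sum_congr rfl h1, Finset.sum_comm]
    refine Finset.sum_congr rfl fun R hR => ?_
    rw [cc_all hsimp hbot n R ((Finset.mem_powerset.1 hR).trans hT), map_sum, Finset.sum_mul]
  have hh0 : 0 < ((hpolyP P ρ n).coeff 0 : ℝ) := by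
    have := f_eq_h (P := P) (ρ := ρ) n 0 (Nat.zero_le _)
    rw [fr_zero hm hbot, Finset.sum_eq_single 0] at this
    · simp at this; rw [← this]; norm_num
    · intro k hk hk0
      rw [Nat.choose_eq_zero_of_lt]
      · simp
      · rw [Finset.mem_range] at hk; omega
    · simp
  have hhR : ∀ k, 0 ≤ ((hpolyP P ρ n).coeff k : ℝ) := fun k => by exact_mod_cast hh k
  set H : Polynomial ℝ := ∑ k ∈ Finset.range (n + 1), C ((hpolyP P ρ n).coeff k : ℝ) * Qp T n k
    with hH
  have hcone : ∀ z : ℂ, 0 < z.im → Cn z (aeval z (Qp T n 0)) (aeval z H) ∧ aeval z H ≠ 0 :=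
    fun z hz => comb_cone T z hz n (fun k => ((hpolyP P ρ n).coeff k : ℝ)) hh0 hhR
  have rH : RealRooted H := nonreal_of_upper fun z hz => (hcone z hz).2
  have rA : RealRooted (Qp T n 0) := nonreal_of_upper fun z hz => (Qp_cone T z hz n).2
  have nH : H ≠ 0 := fun h => (hcone Complex.I (by simp)).2 (by rw [h]; simp)
  have nA : Qp T n 0 ≠ 0 := fun h =>
    (Qp_cone T Complex.I (by simp) n).2 (by rw [h]; simp)
  have cH : ∀ i, 0 ≤ H.coeff i := by
    intro i
    rw [hH, finsetSum_coeff]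
    refine Finset.sum_nonneg fun k _ => ?_
    rw [coeff_C_mul]
    exact mul_nonneg (hhR k) (Qp_nonneg T n k i)
  refine ⟨?_, ?_, ?_⟩
  · rw [chainPoly_eq hm hbot T h0]
    apply chain_realRooted T (fun R => ((cc ρ (fun _ => True) R : ℕ) : ℝ))
    · rw [e2]; exact rH
    · rw [e2]; exact nH
  · rw [e1, e2]; exact rH
  · rw [e1, e2, Apoly_eq]
    exact interlaces_of_cone rA rH (leading_pos (Qp_nonneg T n 0) nA) (leading_pos cH nH)
      fun z hz => (hcone z hz).1
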